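/- Let φ : ℝ³ → ℝ be a fixed smooth nonnegative function, compactly supported in B₁, with ∫_{ℝ³} φ(x) dx = 1. There exist η₀ ∈ (0,1) and C > 0, depending only on φ, such that the following holds for every 0 < η ≤ η₀. Let (u,P) be a smooth solution of the incompressible Navier–Stokes equations on Q₂ = (−4,0) × B₂ satisfying, for every t ∈ (−4,0), ∫_{ℝ³} φ(x) u(t,x) dx = 0 and ∫_{ℝ³} φ(x) P(t,x) dx = 0, together with ∫_{−4}^0 ∫_{B₂} |∇u|² dx dt ≤ η and ∫_{−4}^0 ∫_{B₂} |∇²P| dx dt ≤ η. Then sup_{−9/4 < t < 0} ( ∫_{B_{3/2}} |u(t,x)|^{3/2} dx )^{2/3} ≤ C η^{1/3}. -/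

import Mathlib

open MeasureTheory Set Metric
open scoped ENNReal NNReal

noncomputable section

/-- `ℝ³` with the Euclidean norm. -/
abbrev E3 := EuclideanSpace ℝ (Fin 3)

/-- Spatial partial derivative `∂ⱼ f` of a scalar function. -/
def pd (f : E3 → ℝ) (j : Fin 3) (x : E3) : ℝ :=
  fderiv ℝ f x (EuclideanSpace.single j 1)

/-- `|∇f|² = Σ_{i,j} |∂ⱼ fᵢ|²`. -/
def gradSq (f : E3 → E3) (x : E3) : ℝ :=
  ∑ i, ∑ j, (pd (fun y => f y i) j x) ^ 2

/-- `(u,P)` is a smooth solution of the incompressible Navier–Stokes equations on the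
open set `U ⊆ ℝ × ℝ³`: `u` and `P` are infinitely differentiable on `U`, and on `U` one has
`∂ₜuᵢ + Σⱼ uⱼ ∂ⱼuᵢ + ∂ᵢP − Δuᵢ = 0` and `div u = 0`. -/
def IsNSSolution (u : ℝ → E3 → E3) (P : ℝ → E3 → ℝ) (U : Set (ℝ × E3)) : Prop :=
  ContDiffOn ℝ (⊤ : ℕ∞) (fun q : ℝ × E3 => u q.1 q.2) U ∧
  ContDiffOn ℝ (⊤ : ℕ∞) (fun q : ℝ × E3 => P q.1 q.2) U ∧
  (∀ q ∈ U, ∀ i : Fin 3,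
    deriv (fun s => u s q.2 i) q.1
      + (∑ j, u q.1 q.2 j * pd (fun y => u q.1 y i) j q.2)
      + pd (fun y => P q.1 y) i q.2
      - ∑ j, pd (pd (fun y => u q.1 y i) j) j q.2 = 0) ∧
  (∀ q ∈ U, ∑ i, pd (fun y => u q.1 y i) i q.2 = 0)

/-! ### Poincaré and Sobolev inequalities on balls -/

lemma lintegral_rpow_le_of_prob {α : Type*} [MeasurableSpace α] (μ : Measure α)
    [IsProbabilityMeasure μ] {p : ℝ} (hp : 1 ≤ p) {g : α → ℝ≥0∞} (hg : AEMeasurable g μ) :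
    (∫⁻ a, g a ∂μ) ^ p ≤ ∫⁻ a, g a ^ p ∂μ := by
  have hp0 : 0 < p := by linarith
  rcases hp.eq_or_lt with rfl | hp1
  · simp
  have hpq := Real.HolderConjugate.conjExponent hp1
  have := ENNReal.lintegral_mul_le_Lp_mul_Lq μ hpq hg (g := fun _ => 1) aemeasurable_const
  simp only [Pi.mul_apply, mul_one, ENNReal.one_rpow, lintegral_const, measure_univ] at this
  calc (∫⁻ a, g a ∂μ) ^ p ≤ ((∫⁻ a, g a ^ p ∂μ) ^ (1 / p)) ^ p := by gcongr
    _ = _ := by rw [← ENNReal.rpow_mul]; field_simp; simp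

lemma lintegral_comp_add_smul_le {G : E3 → ℝ≥0∞} (hG : Measurable G) (a : E3) {s : ℝ}
    (hs : 1 / 2 ≤ s) : ∫⁻ x, G (a + s • x) ≤ 8 * ∫⁻ x, G x := by
  have hs0 : s ≠ 0 := by linarith
  have h1 : ∫⁻ x, G (a + s • x) = ∫⁻ x, G (a + x) ∂(Measure.map (s • ·) volume) := by
    exact (lintegral_map (hG.comp (measurable_const_add a)) (measurable_const_smul s)).symm
  rw [h1, Measure.map_addHaar_smul volume hs0, lintegral_smul_measure,
    lintegral_add_left_eq_self (fun x => G x) a, smul_eq_mul]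
  gcongr
  have : (8 : ℝ≥0∞) = ENNReal.ofReal 8 := by simp
  rw [this]
  apply ENNReal.ofReal_le_ofReal
  rw [finrank_euclideanSpace_fin, abs_of_pos (by positivity), inv_le_comm₀ (by positivity) (by norm_num)]
  calc (8 : ℝ)⁻¹ = (1 / 2) ^ 3 := by norm_num
    _ ≤ s ^ 3 := by gcongr

lemma lintegral_lintegral_segment_le {G : E3 → ℝ≥0∞} (hG : Measurable G) (B : Set E3) {s : ℝ} :
    ∫⁻ x in B, ∫⁻ y in B, G (y + s • (x - y)) ≤ 8 * volume B * ∫⁻ x, G x := by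
  rcases le_total (1 / 2) s with hs | hs
  · rw [lintegral_lintegral_swap]
    · calc _ ≤ ∫⁻ y in B, 8 * ∫⁻ x, G x := by
            gcongr with y
            refine (setLIntegral_le_lintegral _ _).trans ?_
            refine (lintegral_mono fun x => le_of_eq ?_).trans
              (lintegral_comp_add_smul_le hG ((1 - s) • y) hs)
            congr 1
            module
        _ = _ := by rw [setLIntegral_const]; ring
    · apply Measurable.aemeasurable
      exact hG.comp (by fun_prop)
  · calc _ ≤ ∫⁻ x in B, 8 * ∫⁻ x, G x := by
            gcongr with x
            refine (setLIntegral_le_lintegral _ _).trans ?_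
            refine (lintegral_mono fun y => le_of_eq ?_).trans
              (lintegral_comp_add_smul_le hG (s • x) (s := 1 - s) (by linarith))
            congr 1
            module
        _ = _ := by rw [setLIntegral_const]; ring

lemma enorm_sub_le_lintegral_fderiv {f : E3 → ℝ} {U : Set E3} (hU : IsOpen U) (hc : Convex ℝ U)
    (hf : ContDiffOn ℝ 1 f U) {x y : E3} (hx : x ∈ U) (hy : y ∈ U) :
    ‖f x - f y‖ₑ ≤ ∫⁻ s in Ioc (0:ℝ) 1, ‖fderiv ℝ f (y + s • (x - y))‖ₑ * ‖x - y‖ₑ := by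
  have hmem : ∀ s ∈ Icc (0:ℝ) 1, y + s • (x - y) ∈ U := fun s hs =>
    hc.add_smul_sub_mem hy hx hs
  have hderiv : ∀ s ∈ uIcc (0:ℝ) 1, HasDerivAt (fun s : ℝ => f (y + s • (x - y)))
      (fderiv ℝ f (y + s • (x - y)) (x - y)) s := by
    intro s hs
    rw [uIcc_of_le zero_le_one] at hs
    have h1 : HasFDerivAt f (fderiv ℝ f (y + s • (x - y))) (y + s • (x - y)) :=
      ((hf.contDiffAt (hU.mem_nhds (hmem s hs))).differentiableAt (by simp)).hasFDerivAt
    have h2 : HasDerivAt (fun s : ℝ => y + s • (x - y)) (x - y) s := by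
      simpa using ((hasDerivAt_id s).smul_const (x - y)).const_add y
    exact h1.comp_hasDerivAt s h2
  have hcont : ContinuousOn (fun s : ℝ => fderiv ℝ f (y + s • (x - y)) (x - y)) (uIcc 0 1) := by
    rw [uIcc_of_le zero_le_one]
    refine ContinuousOn.clm_apply ?_ continuousOn_const
    refine (hf.continuousOn_fderiv_of_isOpen hU le_rfl).comp (by fun_prop) hmem
  have h := intervalIntegral.integral_eq_sub_of_hasDerivAt hderiv hcont.intervalIntegrable
  simp only [one_smul, add_sub_cancel, zero_smul, add_zero] at h
  rw [← h, intervalIntegral.integral_of_le zero_le_one]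
  refine (enorm_integral_le_lintegral_enorm _).trans ?_
  gcongr with s
  exact ContinuousLinearMap.le_opENorm _ _

lemma lintegral_lintegral_sub_le {f : E3 → ℝ} {R : ℝ} (hR : 0 < R) {p : ℝ} (hp : 1 ≤ p)
    (hf : ContDiffOn ℝ 1 f (ball 0 R)) :
    ∫⁻ x in ball (0:E3) R, ∫⁻ y in ball (0:E3) R, ‖f x - f y‖ₑ ^ p ≤
      ENNReal.ofReal (2 * R) ^ p * (8 * volume (ball (0:E3) R)) *
        ∫⁻ x in ball (0:E3) R, ‖fderiv ℝ f x‖ₑ ^ p := by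
  set B := ball (0:E3) R with hB
  set c := ENNReal.ofReal (2 * R) with hcdef
  set G : E3 → ℝ≥0∞ := B.indicator (fun x => ‖fderiv ℝ f x‖ₑ ^ p) with hGdef
  have hBm : MeasurableSet B := measurableSet_ball
  have hG : Measurable G := by
    have := (hf.continuousOn_fderiv_of_isOpen isOpen_ball le_rfl).enorm
    classical
    rw [hGdef, ← piecewise_eq_indicator]
    exact ((ENNReal.continuous_rpow_const (y := p)).comp_continuousOn this).measurable_piecewise
      continuousOn_const hBm
  have hGint : ∫⁻ x, G x = ∫⁻ x in B, ‖fderiv ℝ f x‖ₑ ^ p := lintegral_indicator hBm _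
  have : IsProbabilityMeasure (volume.restrict (Ioc (0:ℝ) 1)) := ⟨by simp⟩
  have key : ∀ x ∈ B, ∀ y ∈ B, ‖f x - f y‖ₑ ^ p ≤
      c ^ p * ∫⁻ s in Ioc (0:ℝ) 1, G (y + s • (x - y)) := by
    intro x hx y hy
    have hmem : ∀ s ∈ Icc (0:ℝ) 1, y + s • (x - y) ∈ B := fun s hs =>
      (convex_ball _ _).add_smul_sub_mem hy hx hs
    have hxy : ‖x - y‖ₑ ≤ c := by
      rw [← ofReal_norm]
      apply ENNReal.ofReal_le_ofReal
      have h1 := mem_ball_zero_iff.1 hx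
      have h2 := mem_ball_zero_iff.1 hy
      linarith [norm_sub_le x y]
    have hm : AEMeasurable (fun s : ℝ => ‖fderiv ℝ f (y + s • (x - y))‖ₑ)
        (volume.restrict (Ioc (0:ℝ) 1)) := by
      refine ContinuousOn.aemeasurable ?_ measurableSet_Ioc
      refine ContinuousOn.enorm ?_
      exact (hf.continuousOn_fderiv_of_isOpen isOpen_ball le_rfl).comp (by fun_prop)
        fun s hs => hmem s (Ioc_subset_Icc_self hs)
    calc ‖f x - f y‖ₑ ^ p
        ≤ (c * ∫⁻ s in Ioc (0:ℝ) 1, ‖fderiv ℝ f (y + s • (x - y))‖ₑ) ^ p := by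
          gcongr
          refine (enorm_sub_le_lintegral_fderiv isOpen_ball (convex_ball _ _) hf hx hy).trans ?_
          rw [lintegral_mul_const'' _ hm, mul_comm]
          gcongr
      _ = c ^ p * (∫⁻ s in Ioc (0:ℝ) 1, ‖fderiv ℝ f (y + s • (x - y))‖ₑ) ^ p :=
          ENNReal.mul_rpow_of_nonneg _ _ (by linarith)
      _ ≤ c ^ p * ∫⁻ s in Ioc (0:ℝ) 1, ‖fderiv ℝ f (y + s • (x - y))‖ₑ ^ p := by
          gcongr
          exact lintegral_rpow_le_of_prob _ hp hm
      _ = _ := by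
          congr 1
          refine setLIntegral_congr_fun measurableSet_Ioc fun s hs => ?_
          simp only [hGdef]
          rw [indicator_of_mem (hmem s (Ioc_subset_Icc_self hs))]
  have hjoint : Measurable (fun q : (E3 × E3) × ℝ => G (q.1.2 + q.2 • (q.1.1 - q.1.2))) :=
    hG.comp (by fun_prop)
  calc ∫⁻ x in B, ∫⁻ y in B, ‖f x - f y‖ₑ ^ p
      ≤ ∫⁻ x in B, ∫⁻ y in B, c ^ p * ∫⁻ s in Ioc (0:ℝ) 1, G (y + s • (x - y)) := by
        refine setLIntegral_mono' hBm fun x hx => setLIntegral_mono' hBm fun y hy => key x hx y hy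
    _ = c ^ p * ∫⁻ s in Ioc (0:ℝ) 1, ∫⁻ x in B, ∫⁻ y in B, G (y + s • (x - y)) := by
        have e1 : ∀ x : E3, ∫⁻ y in B, c ^ p * ∫⁻ s in Ioc (0:ℝ) 1, G (y + s • (x - y))
            = c ^ p * ∫⁻ s in Ioc (0:ℝ) 1, ∫⁻ y in B, G (y + s • (x - y)) := by
          intro x
          rw [lintegral_const_mul' _ _ (by finiteness), lintegral_lintegral_swap]
          exact (hG.comp (by fun_prop)).aemeasurable
        simp_rw [e1]
        rw [lintegral_const_mul' _ _ (by finiteness), lintegral_lintegral_swap]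
        apply Measurable.aemeasurable
        apply Measurable.lintegral_prod_right (f := fun (z : E3 × ℝ) (y : E3) => G (y + z.2 • (z.1 - y)))
        exact hG.comp (by fun_prop)
    _ ≤ c ^ p * ∫⁻ s in Ioc (0:ℝ) 1, 8 * volume B * ∫⁻ x, G x := by
        gcongr with s
        exact lintegral_lintegral_segment_le hG B
    _ = _ := by rw [hGint, lintegral_const, measure_univ]; ring

/-- Poincaré inequality on a ball, with the mean weighted by `φ`. -/
lemma exists_poincare (φ : E3 → ℝ) (hφs : Continuous φ) (hφ0 : ∀ x, 0 ≤ φ x) {R : ℝ} (hR : 0 < R)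
    (hφsupp : tsupport φ ⊆ ball (0:E3) R) (hφint : ∫ x : E3, φ x = 1) {p : ℝ} (hp : 1 ≤ p) :
    ∃ K : ℝ≥0∞, K ≠ ∞ ∧ ∀ f : E3 → ℝ, ContDiffOn ℝ 1 f (ball 0 R) →
      ∫⁻ x in ball (0:E3) R, ‖f x‖ₑ ^ p ≤
        K * ((∫⁻ x in ball (0:E3) R, ‖fderiv ℝ f x‖ₑ ^ p) + ‖∫ x, φ x * f x‖ₑ ^ p) := by
  set B := ball (0:E3) R with hB
  have hBm : MeasurableSet B := measurableSet_ball
  have hφc : HasCompactSupport φ :=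
    HasCompactSupport.of_support_subset_isCompact (isCompact_closedBall (0:E3) R)
      ((subset_tsupport φ).trans (hφsupp.trans ball_subset_closedBall))
  obtain ⟨M, hM⟩ := hφs.bounded_above_of_compact_support hφc
  have hφi : Integrable φ := hφs.integrable_of_hasCompactSupport hφc
  have hφB : ∀ y, y ∉ B → φ y = 0 := fun y hy =>
    image_eq_zero_of_notMem_tsupport fun h => hy (hφsupp h)
  set ν := (volume.restrict B).withDensity (fun x => ENNReal.ofReal (φ x)) with hν
  have hνp : IsProbabilityMeasure ν := by
    refine ⟨?_⟩
    rw [hν, withDensity_apply _ MeasurableSet.univ, Measure.restrict_univ,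
      setLIntegral_eq_of_support_subset,
      ← ofReal_integral_eq_lintegral_ofReal hφi (ae_of_all _ hφ0), hφint, ENNReal.ofReal_one]
    exact fun y hy => by_contra fun h => hy (by simp [hφB y h])
  have hp0 : 0 ≤ p := by linarith
  have hφm : Measurable fun x => ENNReal.ofReal (φ x) := hφs.measurable.ennreal_ofReal
  set c := ENNReal.ofReal (2 * R) ^ p * (8 * volume B) with hc
  have hVB : volume B ≠ ∞ := measure_ball_lt_top.ne
  refine ⟨2 ^ (p - 1) * (ENNReal.ofReal M * c + volume B), by finiteness, fun f hf => ?_⟩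
  set m := ∫ x, φ x * f x with hm
  have hfc : Continuous fun x => φ x * f x := by
    rw [continuous_iff_continuousAt]
    intro x
    by_cases hx : x ∈ tsupport φ
    · exact hφs.continuousAt.mul (hf.continuousOn.continuousAt (isOpen_ball.mem_nhds (hφsupp hx)))
    · have : (fun x => φ x * f x) =ᶠ[nhds x] fun _ => 0 := by
        filter_upwards [notMem_tsupport_iff_eventuallyEq.1 hx] with y hy
        simp [hy]
      exact continuousAt_const.congr this.symm
  have hfi : Integrable fun x => φ x * f x := hfc.integrable_of_hasCompactSupport hφc.mul_right
  have hpt : ∀ x, ‖f x - m‖ₑ ^ p ≤ ENNReal.ofReal M * ∫⁻ y in B, ‖f x - f y‖ₑ ^ p := by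
    intro x
    have e : f x - m = ∫ y, φ y * (f x - f y) := by
      simp_rw [mul_sub]
      rw [integral_sub (hφi.mul_const _) hfi, integral_mul_const, hφint, one_mul]
    have hmeas : AEMeasurable (fun y => ‖f x - f y‖ₑ) (volume.restrict B) :=
      (ContinuousOn.aemeasurable (by
        exact (continuousOn_const.sub hf.continuousOn).enorm) hBm)
    have hmν : AEMeasurable (fun y => ‖f x - f y‖ₑ) ν := by
      exact hmeas.mono_ac (withDensity_absolutelyContinuous _ _)
    calc ‖f x - m‖ₑ ^ p ≤ (∫⁻ y, ‖f x - f y‖ₑ ∂ν) ^ p := by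
          gcongr
          rw [e]
          refine (enorm_integral_le_lintegral_enorm _).trans ?_
          rw [hν, lintegral_withDensity_eq_lintegral_mul₀ hφm.aemeasurable hmeas]
          rw [← lintegral_indicator hBm]
          refine lintegral_mono fun y => ?_
          by_cases hy : y ∈ B
          · rw [indicator_of_mem hy, enorm_mul, Real.enorm_of_nonneg (hφ0 y)]
            rfl
          · simp [hφB y hy]
      _ ≤ ∫⁻ y, ‖f x - f y‖ₑ ^ p ∂ν := lintegral_rpow_le_of_prob _ hp hmν
      _ = ∫⁻ y in B, ENNReal.ofReal (φ y) * ‖f x - f y‖ₑ ^ p := by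
          rw [hν, lintegral_withDensity_eq_lintegral_mul₀ hφm.aemeasurable (hmeas.pow_const p)]
          rfl
      _ ≤ ∫⁻ y in B, ENNReal.ofReal M * ‖f x - f y‖ₑ ^ p := by
          gcongr with y
          exact (le_abs_self _).trans (hM y)
      _ = _ := lintegral_const_mul' _ _ (by finiteness)
  calc ∫⁻ x in B, ‖f x‖ₑ ^ p
      ≤ ∫⁻ x in B, 2 ^ (p - 1) * (ENNReal.ofReal M * (∫⁻ y in B, ‖f x - f y‖ₑ ^ p) + ‖m‖ₑ ^ p) := by
        gcongr with x
        calc ‖f x‖ₑ ^ p ≤ (‖f x - m‖ₑ + ‖m‖ₑ) ^ p := by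
              gcongr
              simpa using enorm_add_le (f x - m) m
          _ ≤ 2 ^ (p - 1) * (‖f x - m‖ₑ ^ p + ‖m‖ₑ ^ p) :=
              ENNReal.rpow_add_le_mul_rpow_add_rpow _ _ hp
          _ ≤ _ := by gcongr; exact hpt x
    _ = 2 ^ (p - 1) * (ENNReal.ofReal M * (∫⁻ x in B, ∫⁻ y in B, ‖f x - f y‖ₑ ^ p)
          + ‖m‖ₑ ^ p * volume B) := by
        rw [lintegral_const_mul' _ _ (by finiteness), lintegral_add_right _ measurable_const,
          lintegral_const_mul' _ _ (by finiteness), lintegral_const, Measure.restrict_apply_univ]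
    _ ≤ 2 ^ (p - 1) * (ENNReal.ofReal M * (c * ∫⁻ x in B, ‖fderiv ℝ f x‖ₑ ^ p)
          + ‖m‖ₑ ^ p * volume B) := by
        gcongr
        exact lintegral_lintegral_sub_le hR hp hf
    _ ≤ _ := by
        rw [mul_assoc ((2 : ℝ≥0∞) ^ (p - 1)) (_ + _)]
        refine mul_le_mul' le_rfl ?_
        rw [add_mul, mul_add, mul_add, ← mul_assoc, mul_comm (‖m‖ₑ ^ p)]
        exact add_le_add le_self_add le_add_self

lemma contDiff_mul_of_tsupport_subset {ψ f : E3 → ℝ} {U : Set E3} {n : WithTop ℕ∞}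
    (hψ : ContDiff ℝ n ψ) (hU : IsOpen U) (hsupp : tsupport ψ ⊆ U) (hf : ContDiffOn ℝ n f U) :
    ContDiff ℝ n fun x => ψ x * f x := by
  rw [contDiff_iff_contDiffAt]
  intro x
  by_cases hx : x ∈ tsupport ψ
  · exact hψ.contDiffAt.mul (hf.contDiffAt (hU.mem_nhds (hsupp hx)))
  · have : (fun x => ψ x * f x) =ᶠ[nhds x] fun _ => 0 := by
      filter_upwards [notMem_tsupport_iff_eventuallyEq.1 hx] with y hy
      simp [hy]
    exact contDiffAt_const.congr_of_eventuallyEq this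

/-- Sobolev inequality on a ball, in terms of the gradient on a larger ball and of the mean
weighted by `φ`. -/
lemma exists_sobolev (φ : E3 → ℝ) (hφs : Continuous φ) (hφ0 : ∀ x, 0 ≤ φ x) {r R : ℝ}
    (hr : 0 < r) (hrR : r < R) (hφsupp : tsupport φ ⊆ ball (0:E3) R) (hφint : ∫ x : E3, φ x = 1)
    {p p' : ℝ≥0} (hp : 1 ≤ p) (hp0' : 0 < p') (hp' : (p' : ℝ)⁻¹ = (p : ℝ)⁻¹ - (3 : ℝ)⁻¹) :
    ∃ K : ℝ≥0∞, K ≠ ∞ ∧ ∀ f : E3 → ℝ, ContDiffOn ℝ 1 f (ball 0 R) →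
      (∫⁻ x in ball (0:E3) r, ‖f x‖ₑ ^ (p' : ℝ)) ^ ((p : ℝ) / p') ≤
        K * ((∫⁻ x in ball (0:E3) R, ‖fderiv ℝ f x‖ₑ ^ (p : ℝ)) + ‖∫ x, φ x * f x‖ₑ ^ (p : ℝ)) := by
  obtain ⟨K, hK, hpoin⟩ := exists_poincare φ hφs hφ0 (hr.trans hrR) hφsupp hφint
    (p := p) (by exact_mod_cast hp)
  let χ : ContDiffBump (0 : E3) := ⟨r, (r + R) / 2, hr, by linarith⟩
  have hχs : ContDiff ℝ 1 χ := χ.contDiff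
  have hχR : tsupport χ ⊆ ball (0:E3) R := by
    rw [χ.tsupport_eq]
    exact closedBall_subset_ball (by change (r + R) / 2 < R; linarith)
  obtain ⟨M, hM⟩ := (hχs.continuous_fderiv one_ne_zero).bounded_above_of_compact_support
    (χ.hasCompactSupport.fderiv (𝕜 := ℝ))
  set S : ℝ≥0∞ := ENNReal.ofNNReal (SNormLESNormFDerivOfEqConst ℝ (volume : Measure E3) p)
  have hp1 : (1 : ℝ) ≤ p := by exact_mod_cast hp
  have hp0 : (0 : ℝ) < p := by linarith
  have hp0'' : (0 : ℝ) < p' := by exact_mod_cast hp0'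
  set B := ball (0:E3) R with hB
  have hBm : MeasurableSet B := measurableSet_ball
  refine ⟨S ^ (p : ℝ) * (2 ^ ((p : ℝ) - 1) * (1 + ENNReal.ofReal M ^ (p : ℝ) * K)), by finiteness,
    fun f hf => ?_⟩
  set g : E3 → ℝ := fun x => χ x * f x with hg
  have hgs : ContDiff ℝ 1 g := contDiff_mul_of_tsupport_subset hχs isOpen_ball hχR hf
  have hgc : HasCompactSupport g := χ.hasCompactSupport.mul_right
  have hsob := eLpNorm_le_eLpNorm_fderiv_of_eq (volume : Measure E3) hgs hgc (p := p) (p' := p') hp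
    (by simp) (by simpa using hp')
  rw [eLpNorm_nnreal_eq_lintegral hp0'.ne', eLpNorm_nnreal_eq_lintegral (by positivity)] at hsob
  have hfder : ∀ x, ‖fderiv ℝ g x‖ₑ ^ (p : ℝ) ≤ B.indicator (fun x => 2 ^ ((p : ℝ) - 1) *
      (‖fderiv ℝ f x‖ₑ ^ (p : ℝ) + ENNReal.ofReal M ^ (p : ℝ) * ‖f x‖ₑ ^ (p : ℝ))) x := by
    intro x
    by_cases hx : x ∈ B
    · rw [indicator_of_mem hx]
      have hfx : DifferentiableAt ℝ f x :=
        (hf.contDiffAt (isOpen_ball.mem_nhds hx)).differentiableAt one_ne_zero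
      have e : fderiv ℝ g x = χ x • fderiv ℝ f x + f x • fderiv ℝ χ x :=
        fderiv_fun_mul (hχs.differentiable one_ne_zero x) hfx
      calc ‖fderiv ℝ g x‖ₑ ^ (p : ℝ)
          ≤ (‖fderiv ℝ f x‖ₑ + ENNReal.ofReal M * ‖f x‖ₑ) ^ (p : ℝ) := by
            gcongr
            have hM0 : 0 ≤ M := (norm_nonneg _).trans (hM x)
            have h1 : ‖fderiv ℝ g x‖ ≤ ‖fderiv ℝ f x‖ + M * ‖f x‖ := by
              rw [e]
              refine (norm_add_le _ _).trans ?_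
              rw [norm_smul, norm_smul, mul_comm ‖f x‖, Real.norm_of_nonneg χ.nonneg]
              gcongr
              · exact mul_le_of_le_one_left (norm_nonneg _) χ.le_one
              · exact hM x
            rw [← ofReal_norm, ← ofReal_norm, ← ofReal_norm, ← ENNReal.ofReal_mul hM0,
              ← ENNReal.ofReal_add (by positivity) (by positivity)]
            exact ENNReal.ofReal_le_ofReal h1
        _ ≤ _ := ENNReal.rpow_add_le_mul_rpow_add_rpow _ _ hp1
        _ = _ := by rw [ENNReal.mul_rpow_of_nonneg _ _ hp0.le]
    · have hx' : x ∉ tsupport g := fun h => hx (hχR (tsupport_mul_subset_left h))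
      have : fderiv ℝ g x = 0 := by
        by_contra h
        exact hx' (support_fderiv_subset ℝ h)
      rw [this, ← ofReal_norm, norm_zero, ENNReal.ofReal_zero, ENNReal.zero_rpow_of_pos hp0]
      exact zero_le
  have hfm : AEMeasurable (fun x => ‖fderiv ℝ f x‖ₑ ^ (p : ℝ)) (volume.restrict B) :=
    ((hf.continuousOn_fderiv_of_isOpen isOpen_ball le_rfl).enorm.aemeasurable hBm).pow_const _
  calc (∫⁻ x in ball (0:E3) r, ‖f x‖ₑ ^ (p' : ℝ)) ^ ((p : ℝ) / p')
      ≤ (∫⁻ x, ‖g x‖ₑ ^ (p' : ℝ)) ^ ((p : ℝ) / p') := by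
        refine ENNReal.rpow_le_rpow ?_ (by positivity)
        refine le_trans (le_of_eq ?_) (setLIntegral_le_lintegral (ball (0:E3) r) _)
        refine setLIntegral_congr_fun measurableSet_ball fun x hx => ?_
        simp only [hg]
        rw [χ.one_of_mem_closedBall (ball_subset_closedBall hx), one_mul]
    _ = ((∫⁻ x, ‖g x‖ₑ ^ (p' : ℝ)) ^ (1 / (p' : ℝ))) ^ (p : ℝ) := by
        rw [← ENNReal.rpow_mul]; congr 1; field_simp
    _ ≤ (S * (∫⁻ x, ‖fderiv ℝ g x‖ₑ ^ (p : ℝ)) ^ (1 / (p : ℝ))) ^ (p : ℝ) := by gcongr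
    _ = S ^ (p : ℝ) * ∫⁻ x, ‖fderiv ℝ g x‖ₑ ^ (p : ℝ) := by
        rw [ENNReal.mul_rpow_of_nonneg _ _ hp0.le, ← ENNReal.rpow_mul]
        simp [hp0.ne']
    _ ≤ S ^ (p : ℝ) * (2 ^ ((p : ℝ) - 1) * ((∫⁻ x in B, ‖fderiv ℝ f x‖ₑ ^ (p : ℝ)) +
          ENNReal.ofReal M ^ (p : ℝ) * ∫⁻ x in B, ‖f x‖ₑ ^ (p : ℝ))) := by
        gcongr
        refine (lintegral_mono hfder).trans ?_
        rw [lintegral_indicator hBm, lintegral_const_mul' _ _ (by finiteness),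
          lintegral_add_left' hfm, lintegral_const_mul' _ _ (by finiteness)]
    _ ≤ S ^ (p : ℝ) * (2 ^ ((p : ℝ) - 1) * (((∫⁻ x in B, ‖fderiv ℝ f x‖ₑ ^ (p : ℝ)) +
          ‖∫ x, φ x * f x‖ₑ ^ (p : ℝ)) + ENNReal.ofReal M ^ (p : ℝ) * (K *
            ((∫⁻ x in B, ‖fderiv ℝ f x‖ₑ ^ (p : ℝ)) + ‖∫ x, φ x * f x‖ₑ ^ (p : ℝ))))) := by
        gcongr
        · exact le_self_add
        · exact hpoin f hf
    _ = _ := by ring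

lemma norm_sq_le_sum_sq_apply_single (L : E3 →L[ℝ] ℝ) :
    ‖L‖ ^ 2 ≤ ∑ j, (L (EuclideanSpace.single j 1)) ^ 2 := by
  have hS : 0 ≤ ∑ j, (L (EuclideanSpace.single j 1)) ^ 2 := Finset.sum_nonneg fun _ _ => sq_nonneg _
  have h : ‖L‖ ≤ √(∑ j, (L (EuclideanSpace.single j 1)) ^ 2) := by
    refine L.opNorm_le_bound (Real.sqrt_nonneg _) fun v => ?_
    have hv : v = ∑ j, v j • EuclideanSpace.single j (1 : ℝ) := by
      ext i
      simp [Finset.sum_apply, Pi.single_apply]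
    have hLv : L v = ∑ j, v j * L (EuclideanSpace.single j 1) := by
      conv_lhs => rw [hv]
      simp
    rw [hLv, EuclideanSpace.norm_eq, ← Real.sqrt_mul hS]
    refine Real.abs_le_sqrt ?_
    refine (Finset.sum_mul_sq_le_sq_mul_sq _ _ _).trans ?_
    rw [mul_comm]
    simp
  calc ‖L‖ ^ 2 ≤ √(∑ j, (L (EuclideanSpace.single j 1)) ^ 2) ^ 2 := by gcongr
    _ = _ := Real.sq_sqrt hS

lemma norm_le_sum_abs_apply_single (L : E3 →L[ℝ] ℝ) :
    ‖L‖ ≤ ∑ j, |L (EuclideanSpace.single j 1)| := by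
  refine abs_le_of_sq_le_sq' ?_ (Finset.sum_nonneg fun _ _ => abs_nonneg _) |>.2
  refine (norm_sq_le_sum_sq_apply_single L).trans ?_
  simp_rw [← sq_abs (L _)]
  exact Finset.sum_sq_le_sq_sum_of_nonneg fun _ _ => abs_nonneg _

lemma integrableOn_ball_of_continuousOn {f : E3 → ℝ} {r R : ℝ} (hrR : r < R)
    (hf : ContinuousOn f (ball 0 R)) : IntegrableOn f (ball 0 r) :=
  ((hf.mono (closedBall_subset_ball hrR)).integrableOn_compact
    (isCompact_closedBall _ _)).mono_set ball_subset_closedBall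

lemma lintegral_enorm_rpow_eq {F : Type*} [NormedAddCommGroup F] {f : E3 → F} {r R : ℝ}
    (hrR : r < R) (hf : ContinuousOn f (ball 0 R)) {p : ℝ} (hp : 0 ≤ p) :
    ∫⁻ x in ball (0:E3) r, ‖f x‖ₑ ^ p = ENNReal.ofReal (∫ x in ball (0:E3) r, ‖f x‖ ^ p) := by
  rw [ofReal_integral_eq_lintegral_ofReal]
  · refine lintegral_congr fun x => ?_
    rw [← ofReal_norm, ENNReal.ofReal_rpow_of_nonneg (norm_nonneg _) hp]
  · exact integrableOn_ball_of_continuousOn hrR (hf.norm.rpow_const fun _ _ => Or.inr hp)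
  · exact ae_of_all _ fun x => by positivity

lemma le_mul_of_ofReal_le {a b : ℝ} {K : ℝ≥0∞} (hK : K ≠ ∞) (hb : 0 ≤ b)
    (h : ENNReal.ofReal a ≤ K * ENNReal.ofReal b) : a ≤ (K.toReal + 1) * b := by
  rw [← ENNReal.ofReal_toReal hK, ← ENNReal.ofReal_mul ENNReal.toReal_nonneg,
    ENNReal.ofReal_le_ofReal_iff (by positivity)] at h
  linarith

lemma exists_integral_sq_le (φ : E3 → ℝ) (hφs : Continuous φ) (hφ0 : ∀ x, 0 ≤ φ x) {R : ℝ}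
    (hR0 : 0 < R) (hR : R < 2) (hφsupp : tsupport φ ⊆ ball (0:E3) R) (hφint : ∫ x : E3, φ x = 1) :
    ∃ K > (0:ℝ), ∀ f : E3 → ℝ, ContDiffOn ℝ 1 f (ball 0 2) → ∫ x, φ x * f x = 0 →
      ∫ x in ball (0:E3) R, f x ^ 2 ≤ K * ∫ x in ball (0:E3) R, ∑ j, pd f j x ^ 2 := by
  obtain ⟨K, hK, h⟩ := exists_poincare φ hφs hφ0 hR0 hφsupp hφint (p := 2) (by norm_num)
  refine ⟨K.toReal + 1, by positivity, fun f hf hm => ?_⟩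
  have hf' := hf.continuousOn_fderiv_of_isOpen isOpen_ball le_rfl
  have h1 := h f (hf.mono (ball_subset_ball hR.le))
  rw [lintegral_enorm_rpow_eq hR hf.continuousOn (by norm_num),
    lintegral_enorm_rpow_eq hR hf' (by norm_num), hm, enorm_zero,
    ENNReal.zero_rpow_of_pos (by norm_num), add_zero] at h1
  have h2 := le_mul_of_ofReal_le hK (integral_nonneg fun x => by positivity) h1
  simp only [Real.rpow_two, Real.norm_eq_abs, sq_abs] at h2
  refine h2.trans ?_
  gcongr with x
  · exact integrableOn_ball_of_continuousOn hR (hf'.norm.pow 2)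
  · exact integrableOn_ball_of_continuousOn hR
      (continuousOn_finsetSum _ fun j _ => (hf'.clm_apply continuousOn_const).pow 2)
  · exact measurableSet_ball.nullMeasurableSet
  · exact norm_sq_le_sum_sq_apply_single _

lemma exists_integral_pow_six_le (φ : E3 → ℝ) (hφs : Continuous φ) (hφ0 : ∀ x, 0 ≤ φ x) {r R : ℝ}
    (hr : 0 < r) (hrR : r < R) (hR : R < 2) (hφsupp : tsupport φ ⊆ ball (0:E3) R)
    (hφint : ∫ x : E3, φ x = 1) :
    ∃ K > (0:ℝ), ∀ f : E3 → ℝ, ContDiffOn ℝ 1 f (ball 0 2) → ∫ x, φ x * f x = 0 →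
      (∫ x in ball (0:E3) r, (f x ^ 2) ^ (3:ℝ)) ^ (1 / (3:ℝ)) ≤
        K * ∫ x in ball (0:E3) R, ∑ j, pd f j x ^ 2 := by
  obtain ⟨K, hK, h⟩ := exists_sobolev φ hφs hφ0 hr hrR hφsupp hφint (p := 2) (p' := 6)
    (by norm_num) (by norm_num) (by norm_num)
  refine ⟨K.toReal + 1, by positivity, fun f hf hm => ?_⟩
  have hf' := hf.continuousOn_fderiv_of_isOpen isOpen_ball le_rfl
  have h1 := h f (hf.mono (ball_subset_ball hR.le))
  rw [lintegral_enorm_rpow_eq (hrR.trans hR) hf.continuousOn (by norm_num),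
    lintegral_enorm_rpow_eq hR hf' (by norm_num), hm, enorm_zero,
    ENNReal.zero_rpow_of_pos (by norm_num), add_zero,
    ENNReal.ofReal_rpow_of_nonneg (integral_nonneg fun x => by positivity) (by positivity)] at h1
  have h2 := le_mul_of_ofReal_le hK (integral_nonneg fun x => by positivity) h1
  have e : ∀ x, (f x ^ 2) ^ (3:ℝ) = ‖f x‖ ^ ((6:ℝ≥0):ℝ) := by
    intro x
    rw [Real.norm_eq_abs, ← sq_abs, ← Real.rpow_two, ← Real.rpow_mul (abs_nonneg _)]
    norm_num
  simp_rw [e]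
  rw [show (1 / (3:ℝ)) = ((2:ℝ≥0):ℝ) / ((6:ℝ≥0):ℝ) by norm_num]
  refine h2.trans ?_
  gcongr with x
  · exact integrableOn_ball_of_continuousOn hR (hf'.norm.rpow_const fun _ _ => Or.inr (by simp))
  · exact integrableOn_ball_of_continuousOn hR
      (continuousOn_finsetSum _ fun j _ => (hf'.clm_apply continuousOn_const).pow 2)
  · exact measurableSet_ball.nullMeasurableSet
  · simpa [pd] using norm_sq_le_sum_sq_apply_single (fderiv ℝ f x)

lemma exists_integral_rpow_three_halves_le (φ : E3 → ℝ) (hφs : Continuous φ) (hφ0 : ∀ x, 0 ≤ φ x)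
    {r R : ℝ} (hr : 0 < r) (hrR : r < R) (hR : R < 2) (hφsupp : tsupport φ ⊆ ball (0:E3) R)
    (hφint : ∫ x : E3, φ x = 1) :
    ∃ K > (0:ℝ), ∀ f : E3 → ℝ, ContDiffOn ℝ 1 f (ball 0 2) →
      (∫ x in ball (0:E3) r, |f x| ^ (3 / 2 : ℝ)) ^ (1 / (3 / 2 : ℝ)) ≤
        K * ((∫ x in ball (0:E3) R, ∑ j, |pd f j x|) + |∫ x, φ x * f x|) := by
  obtain ⟨K, hK, h⟩ := exists_sobolev φ hφs hφ0 hr hrR hφsupp hφint (p := 1) (p' := 3 / 2)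
    (by norm_num) (by norm_num) (by norm_num)
  refine ⟨K.toReal + 1, by positivity, fun f hf => ?_⟩
  have hf' := hf.continuousOn_fderiv_of_isOpen isOpen_ball le_rfl
  have h1 := h f (hf.mono (ball_subset_ball hR.le))
  have hnn : 0 ≤ ∫ x in ball (0:E3) R, ‖fderiv ℝ f x‖ ^ ((1:ℝ≥0):ℝ) :=
    integral_nonneg fun x => by positivity
  rw [lintegral_enorm_rpow_eq (hrR.trans hR) hf.continuousOn (by norm_num),
    lintegral_enorm_rpow_eq hR hf' (by norm_num),
    ENNReal.ofReal_rpow_of_nonneg (integral_nonneg fun x => by positivity) (by positivity),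
    ← ofReal_norm (∫ x, φ x * f x), NNReal.coe_one, ENNReal.rpow_one,
    ← ENNReal.ofReal_add (by simpa using hnn) (norm_nonneg _)] at h1
  have h2 := le_mul_of_ofReal_le hK (by simpa using add_nonneg hnn (norm_nonneg (∫ x, φ x * f x))) h1
  simp only [Real.rpow_one, Real.norm_eq_abs] at h2
  have e1 : ((3 / 2 : ℝ≥0) : ℝ) = 3 / 2 := by norm_num
  rw [e1] at h2
  refine h2.trans ?_
  gcongr with x
  · exact integrableOn_ball_of_continuousOn hR hf'.norm
  · exact integrableOn_ball_of_continuousOn hR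
      (continuousOn_finsetSum _ fun j _ => (hf'.clm_apply continuousOn_const).abs)
  · exact measurableSet_ball.nullMeasurableSet
  · exact norm_le_sum_abs_apply_single _

/-! ### Smooth functions on the parabolic cylinder -/

/-- Smoothness on `(-4, 0) × B₂` of a scalar function of time and space. -/
def SmoothOnCyl (G : ℝ → E3 → ℝ) : Prop :=
  ContDiffOn ℝ (⊤ : ℕ∞) (fun q : ℝ × E3 => G q.1 q.2) (Ioo (-4:ℝ) 0 ×ˢ ball (0:E3) 2)

lemma isOpen_cyl : IsOpen (Ioo (-4:ℝ) 0 ×ˢ ball (0:E3) 2) := isOpen_Ioo.prod isOpen_ball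

namespace SmoothOnCyl

variable {G : ℝ → E3 → ℝ}

lemma hasFDerivAt (hG : SmoothOnCyl G) {t : ℝ} (ht : t ∈ Ioo (-4:ℝ) 0) {x : E3}
    (hx : x ∈ ball (0:E3) 2) :
    HasFDerivAt (fun q : ℝ × E3 => G q.1 q.2) (fderiv ℝ (fun q : ℝ × E3 => G q.1 q.2) (t, x))
      (t, x) := by
  have h : ContDiffAt ℝ (⊤ : ℕ∞) (fun q : ℝ × E3 => G q.1 q.2) (t, x) :=
    ContDiffOn.contDiffAt hG (isOpen_cyl.mem_nhds (mk_mem_prod ht hx))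
  exact (h.differentiableAt (by simp)).hasFDerivAt

lemma pd_eq (hG : SmoothOnCyl G) {t : ℝ} (ht : t ∈ Ioo (-4:ℝ) 0) {x : E3}
    (hx : x ∈ ball (0:E3) 2) (j : Fin 3) :
    pd (G t) j x = fderiv ℝ (fun q : ℝ × E3 => G q.1 q.2) (t, x) (0, EuclideanSpace.single j 1) := by
  have h : HasFDerivAt (G t) _ x := (hG.hasFDerivAt ht hx).comp x (hasFDerivAt_prodMk_right t x)
  rw [pd, h.fderiv]
  simp

lemma hasDerivAt (hG : SmoothOnCyl G) {t : ℝ} (ht : t ∈ Ioo (-4:ℝ) 0) {x : E3}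
    (hx : x ∈ ball (0:E3) 2) : HasDerivAt (fun s => G s x)
      (fderiv ℝ (fun q : ℝ × E3 => G q.1 q.2) (t, x) (1, 0)) t := by
  have h : HasDerivAt (fun s : ℝ => (s, x)) (1, 0) t :=
    (hasDerivAt_id t).prodMk (hasDerivAt_const t x)
  exact (hG.hasFDerivAt ht hx).comp_hasDerivAt t h

lemma fderiv_apply (hG : SmoothOnCyl G) (v : ℝ × E3) :
    ContDiffOn ℝ (⊤ : ℕ∞) (fun q : ℝ × E3 => fderiv ℝ (fun q : ℝ × E3 => G q.1 q.2) q v)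
      (Ioo (-4:ℝ) 0 ×ˢ ball (0:E3) 2) :=
  (hG.fderiv_of_isOpen isOpen_cyl (by simp)).clm_apply contDiffOn_const

lemma pd (hG : SmoothOnCyl G) (j : Fin 3) : SmoothOnCyl fun t => _root_.pd (G t) j :=
  (hG.fderiv_apply (0, EuclideanSpace.single j 1)).congr fun _ hq => hG.pd_eq hq.1 hq.2 j

lemma deriv_time (hG : SmoothOnCyl G) : SmoothOnCyl fun t x => deriv (fun s => G s x) t :=
  (hG.fderiv_apply (1, 0)).congr fun _ hq => (hG.hasDerivAt hq.1 hq.2).deriv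

lemma slice (hG : SmoothOnCyl G) {t : ℝ} (ht : t ∈ Ioo (-4:ℝ) 0) :
    ContDiffOn ℝ (⊤ : ℕ∞) (G t) (ball 0 2) :=
  hG.comp (contDiffOn_const.prodMk contDiffOn_id) fun _ hx => ⟨ht, hx⟩

end SmoothOnCyl

lemma hasCompactSupport_of_tsupport_subset_ball {ψ : E3 → ℝ} {R : ℝ}
    (hsupp : tsupport ψ ⊆ ball (0:E3) R) : HasCompactSupport ψ :=
  HasCompactSupport.of_support_subset_isCompact (isCompact_closedBall (0:E3) R)
    ((subset_tsupport ψ).trans (hsupp.trans ball_subset_closedBall))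

lemma integrable_mul_of_tsupport_subset {ψ f : E3 → ℝ} {R : ℝ} (hψ : Continuous ψ)
    (hsupp : tsupport ψ ⊆ ball (0:E3) R) (hf : ContinuousOn f (ball 0 R)) :
    Integrable fun x => ψ x * f x :=
  (contDiff_zero.1 (contDiff_mul_of_tsupport_subset (contDiff_zero.2 hψ) isOpen_ball hsupp
    (contDiffOn_zero.2 hf))).integrable_of_hasCompactSupport
    (hasCompactSupport_of_tsupport_subset_ball hsupp).mul_right

lemma tsupport_pd_subset (ψ : E3 → ℝ) (j : Fin 3) : tsupport (pd ψ j) ⊆ tsupport ψ :=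
  tsupport_fderiv_apply_subset ℝ (EuclideanSpace.single j 1)

lemma contDiff_pd {ψ : E3 → ℝ} (hψ : ContDiff ℝ (⊤ : ℕ∞) ψ) (j : Fin 3) :
    ContDiff ℝ (⊤ : ℕ∞) (pd ψ j) :=
  (hψ.fderiv_right (by simp)).clm_apply contDiff_const

lemma contDiffOn_pd {f : E3 → ℝ} (hf : ContDiffOn ℝ (⊤ : ℕ∞) f (ball 0 2)) (j : Fin 3) :
    ContDiffOn ℝ (⊤ : ℕ∞) (pd f j) (ball 0 2) :=
  (hf.fderiv_of_isOpen isOpen_ball (by simp)).clm_apply contDiffOn_const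

lemma integral_mul_pd {ψ g : E3 → ℝ} (hψ : ContDiff ℝ (⊤ : ℕ∞) ψ)
    (hsupp : tsupport ψ ⊆ ball (0:E3) 2) (hg : ContDiffOn ℝ (⊤ : ℕ∞) g (ball 0 2)) (j : Fin 3) :
    ∫ x, ψ x * pd g j x = -∫ x, pd ψ j x * g x := by
  refine integral_mul_fderiv_eq_neg_fderiv_mul_of_integrable ?_ ?_ ?_ ?_ ?_
  · exact integrable_mul_of_tsupport_subset (contDiff_pd hψ j).continuous
      ((tsupport_pd_subset ψ j).trans hsupp) hg.continuousOn
  · exact integrable_mul_of_tsupport_subset hψ.continuous hsupp (contDiffOn_pd hg j).continuousOn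
  · exact integrable_mul_of_tsupport_subset hψ.continuous hsupp hg.continuousOn
  · exact fun x _ => hψ.differentiable (by simp) x
  · exact fun x hx =>
      (hg.contDiffAt (isOpen_ball.mem_nhds (hsupp hx))).differentiableAt (by simp)

lemma integral_mul_pd_pd {ψ g : E3 → ℝ} (hψ : ContDiff ℝ (⊤ : ℕ∞) ψ)
    (hsupp : tsupport ψ ⊆ ball (0:E3) 2) (hg : ContDiffOn ℝ (⊤ : ℕ∞) g (ball 0 2)) (j : Fin 3) :
    ∫ x, ψ x * pd (pd g j) j x = ∫ x, pd (pd ψ j) j x * g x := by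
  rw [integral_mul_pd hψ hsupp (contDiffOn_pd hg j), integral_mul_pd (contDiff_pd hψ j)
    ((tsupport_pd_subset ψ j).trans hsupp) hg, neg_neg]

lemma SmoothOnCyl.hasDerivAt_integral {G : ℝ → E3 → ℝ} (hG : SmoothOnCyl G) {ψ : E3 → ℝ}
    (hψ : Continuous ψ) (hsupp : tsupport ψ ⊆ ball (0:E3) 2) {t : ℝ} (ht : t ∈ Ioo (-4:ℝ) 0) :
    HasDerivAt (fun s => ∫ x, ψ x * G s x) (∫ x, ψ x * deriv (fun s => G s x) t) t := by
  obtain ⟨δ, hδ, hδt⟩ := Metric.nhds_basis_closedBall.mem_iff.1 (isOpen_Ioo.mem_nhds ht)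
  have hψc := hasCompactSupport_of_tsupport_subset_ball hsupp
  have hK : IsCompact (closedBall t δ ×ˢ tsupport ψ) := (isCompact_closedBall t δ).prod hψc
  obtain ⟨M, hM⟩ := hK.exists_bound_of_continuousOn
    (hG.deriv_time.continuousOn.mono (prod_mono hδt hsupp))
  refine (hasDerivAt_integral_of_dominated_loc_of_deriv_le (s := closedBall t δ)
    (bound := fun x => |ψ x| * M) (F' := fun s x => ψ x * deriv (fun s => G s x) s)
    (closedBall_mem_nhds t hδ) ?_ ?_ ?_ ?_ ?_ ?_).2
  · filter_upwards [isOpen_Ioo.mem_nhds ht] with s hs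
    exact (integrable_mul_of_tsupport_subset hψ hsupp (hG.slice hs).continuousOn).1
  · exact integrable_mul_of_tsupport_subset hψ hsupp (hG.slice ht).continuousOn
  · exact (integrable_mul_of_tsupport_subset hψ hsupp (hG.deriv_time.slice ht).continuousOn).1
  · refine ae_of_all _ fun x s hs => ?_
    by_cases hx : x ∈ tsupport ψ
    · rw [norm_mul, Real.norm_eq_abs]
      gcongr
      exact hM (s, x) ⟨hs, hx⟩
    · simp [image_eq_zero_of_notMem_tsupport hx]
  · exact (hψ.integrable_of_hasCompactSupport hψc).abs.mul_const M
  · refine ae_of_all _ fun x s hs => ?_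
    by_cases hx : x ∈ tsupport ψ
    · exact (hG.hasDerivAt (hδt hs) (hsupp hx)).differentiableAt.hasDerivAt.const_mul _
    · simpa [image_eq_zero_of_notMem_tsupport hx] using hasDerivAt_const s (0 : ℝ)

/-! ### The regularized power `(|u|² + ε)^(3/4)` -/

section Power

variable {ε : ℝ}

lemma sum_sq_add_pos (hε : 0 < ε) (a : Fin 3 → ℝ) : 0 < (∑ k, a k ^ 2) + ε :=
  add_pos_of_nonneg_of_pos (Finset.sum_nonneg fun _ _ => sq_nonneg _) hε

lemma hasDerivAt_sum_sq_add {a : Fin 3 → ℝ → ℝ} {a' : Fin 3 → ℝ} {s : ℝ}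
    (ha : ∀ k, HasDerivAt (a k) (a' k) s) :
    HasDerivAt (fun s => (∑ k, a k s ^ 2) + ε) (2 * ∑ k, a k s * a' k) s := by
  have h := (HasDerivAt.fun_sum (u := Finset.univ) fun k _ => (ha k).fun_pow 2).add_const ε
  refine h.congr_deriv ?_
  rw [Finset.mul_sum]
  refine Finset.sum_congr rfl fun k _ => ?_
  norm_num
  ring

lemma hasDerivAt_rpow_sum_sq (hε : 0 < ε) {a : Fin 3 → ℝ → ℝ} {a' : Fin 3 → ℝ} {s : ℝ}
    (ha : ∀ k, HasDerivAt (a k) (a' k) s) :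
    HasDerivAt (fun s => ((∑ k, a k s ^ 2) + ε) ^ (3 / 4 : ℝ))
      (3 / 2 * ((∑ k, a k s ^ 2) + ε) ^ (-(1 / 4) : ℝ) * ∑ k, a k s * a' k) s := by
  have h := (hasDerivAt_sum_sq_add (ε := ε) ha).rpow_const (p := 3 / 4)
    (Or.inl (sum_sq_add_pos hε _).ne')
  refine h.congr_deriv ?_
  rw [show (3 / 4 - 1 : ℝ) = -(1 / 4) by norm_num]
  ring

lemma hasDerivAt_rpow_mul_sum (hε : 0 < ε) {a b : Fin 3 → ℝ → ℝ} {b' : Fin 3 → ℝ} {s : ℝ}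
    (ha : ∀ k, HasDerivAt (a k) (b k s) s) (hb : ∀ k, HasDerivAt (b k) (b' k) s) :
    HasDerivAt (fun s => 3 / 2 * ((∑ k, a k s ^ 2) + ε) ^ (-(1 / 4) : ℝ) * ∑ k, a k s * b k s)
      (3 / 2 * ((∑ k, a k s ^ 2) + ε) ^ (-(1 / 4) : ℝ) * (∑ k, b k s ^ 2 + ∑ k, a k s * b' k)
        - 3 / 4 * ((∑ k, a k s ^ 2) + ε) ^ (-(5 / 4) : ℝ) * (∑ k, a k s * b k s) ^ 2) s := by
  have h1 := ((hasDerivAt_sum_sq_add (ε := ε) ha).rpow_const (p := -(1 / 4))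
    (Or.inl (sum_sq_add_pos hε _).ne')).const_mul (3 / 2)
  have h2 := HasDerivAt.fun_sum (u := Finset.univ) fun k _ => (ha k).fun_mul (hb k)
  refine (h1.fun_mul h2).congr_deriv ?_
  rw [show (-(1 / 4) - 1 : ℝ) = -(5 / 4) by norm_num, Finset.sum_add_distrib]
  simp_rw [← sq]
  ring

lemma mul_sum_le_second_derivative (hε : 0 < ε) (a b b' : Fin 3 → ℝ) :
    3 / 2 * ((∑ k, a k ^ 2) + ε) ^ (-(1 / 4) : ℝ) * ∑ k, a k * b' k ≤
      3 / 2 * ((∑ k, a k ^ 2) + ε) ^ (-(1 / 4) : ℝ) * (∑ k, b k ^ 2 + ∑ k, a k * b' k)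
        - 3 / 4 * ((∑ k, a k ^ 2) + ε) ^ (-(5 / 4) : ℝ) * (∑ k, a k * b k) ^ 2 := by
  have hX := sum_sq_add_pos hε a
  set X := (∑ k, a k ^ 2) + ε with hXdef
  have hb : 0 ≤ ∑ k, b k ^ 2 := Finset.sum_nonneg fun _ _ => sq_nonneg _
  have h1 : (∑ k, a k * b k) ^ 2 ≤ X * ∑ k, b k ^ 2 := by
    refine (Finset.sum_mul_sq_le_sq_mul_sq _ _ _).trans ?_
    gcongr
    linarith
  have h2 : X ^ (-(5 / 4) : ℝ) * X = X ^ (-(1 / 4) : ℝ) := by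
    rw [← Real.rpow_add_one hX.ne']
    norm_num
  have h3 : X ^ (-(5 / 4) : ℝ) * (∑ k, a k * b k) ^ 2 ≤ X ^ (-(1 / 4) : ℝ) * ∑ k, b k ^ 2 := by
    rw [← h2, mul_assoc]
    gcongr
  have h4 : 0 ≤ X ^ (-(1 / 4) : ℝ) * ∑ k, b k ^ 2 := by positivity
  linarith

lemma pd_eq_of_hasLineDerivAt {f : E3 → ℝ} {x : E3} {j : Fin 3} {c : ℝ}
    (hf : DifferentiableAt ℝ f x)
    (h : HasLineDerivAt ℝ f c x (EuclideanSpace.single j 1)) : pd f j x = c := by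
  rw [pd, ← hf.lineDeriv_eq_fderiv]
  exact h.lineDeriv

lemma hasLineDerivAt_pd {f : E3 → ℝ} {x : E3} (hf : DifferentiableAt ℝ f x) (j : Fin 3) :
    HasLineDerivAt ℝ f (pd f j x) x (EuclideanSpace.single j 1) :=
  hf.hasFDerivAt.hasLineDerivAt _

lemma contDiffOn_rpow_sum_sq {E : Type*} [NormedAddCommGroup E] [NormedSpace ℝ E] (hε : 0 < ε)
    {g : Fin 3 → E → ℝ} {U : Set E} {n : WithTop ℕ∞} (hg : ∀ k, ContDiffOn ℝ n (g k) U) (p : ℝ) :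
    ContDiffOn ℝ n (fun x => ((∑ k, g k x ^ 2) + ε) ^ p) U :=
  ((ContDiffOn.sum fun k _ => (hg k).pow 2).add contDiffOn_const).rpow_const_of_ne
    fun x _ => (sum_sq_add_pos hε fun k => g k x).ne'

lemma pd_rpow_sum_sq (hε : 0 < ε) {g : Fin 3 → E3 → ℝ} {x : E3}
    (hg : ∀ k, ContDiffOn ℝ (⊤ : ℕ∞) (g k) (ball 0 2)) (hx : x ∈ ball (0:E3) 2) (j : Fin 3) :
    pd (fun x => ((∑ k, g k x ^ 2) + ε) ^ (3 / 4 : ℝ)) j x =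
      3 / 2 * ((∑ k, g k x ^ 2) + ε) ^ (-(1 / 4) : ℝ) * ∑ k, g k x * pd (g k) j x := by
  have hd : ∀ {f : E3 → ℝ}, ContDiffOn ℝ (⊤ : ℕ∞) f (ball 0 2) → DifferentiableAt ℝ f x :=
    fun hf => (hf.contDiffAt (isOpen_ball.mem_nhds hx)).differentiableAt (by simp)
  refine pd_eq_of_hasLineDerivAt (hd (contDiffOn_rpow_sum_sq hε hg _)) ?_
  have h := hasDerivAt_rpow_sum_sq hε fun k => hasLineDerivAt_pd (hd (hg k)) j
  simpa using! h

lemma mul_sum_pd_pd_le (hε : 0 < ε) {g : Fin 3 → E3 → ℝ} {x : E3}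
    (hg : ∀ k, ContDiffOn ℝ (⊤ : ℕ∞) (g k) (ball 0 2)) (hx : x ∈ ball (0:E3) 2) (j : Fin 3) :
    3 / 2 * ((∑ k, g k x ^ 2) + ε) ^ (-(1 / 4) : ℝ) * ∑ k, g k x * pd (pd (g k) j) j x ≤
      pd (pd (fun x => ((∑ k, g k x ^ 2) + ε) ^ (3 / 4 : ℝ)) j) j x := by
  have hd : ∀ {f : E3 → ℝ}, ContDiffOn ℝ (⊤ : ℕ∞) f (ball 0 2) → DifferentiableAt ℝ f x :=
    fun hf => (hf.contDiffAt (isOpen_ball.mem_nhds hx)).differentiableAt (by simp)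
  have hev : pd (fun x => ((∑ k, g k x ^ 2) + ε) ^ (3 / 4 : ℝ)) j =ᶠ[nhds x] fun x =>
      3 / 2 * ((∑ k, g k x ^ 2) + ε) ^ (-(1 / 4) : ℝ) * ∑ k, g k x * pd (g k) j x := by
    filter_upwards [isOpen_ball.mem_nhds hx] with y hy using pd_rpow_sum_sq hε hg hy j
  have hs : ContDiffOn ℝ (⊤ : ℕ∞) (fun x =>
      3 / 2 * ((∑ k, g k x ^ 2) + ε) ^ (-(1 / 4) : ℝ) * ∑ k, g k x * pd (g k) j x) (ball 0 2) :=
    (contDiffOn_const.mul (contDiffOn_rpow_sum_sq hε hg _)).mul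
      (ContDiffOn.sum fun k _ => (hg k).mul (contDiffOn_pd (hg k) j))
  have h := hasDerivAt_rpow_mul_sum hε
    (a := fun k s => g k (x + s • EuclideanSpace.single j 1))
    (b := fun k s => pd (g k) j (x + s • EuclideanSpace.single j 1)) (s := 0)
    (fun k => by simpa using! hasLineDerivAt_pd (hd (hg k)) j)
    (fun k => hasLineDerivAt_pd (hd (contDiffOn_pd (hg k) j)) j)
  have h' := pd_eq_of_hasLineDerivAt (hd hs) h
  rw [pd, hev.fderiv_eq, ← pd, h']
  simpa using mul_sum_le_second_derivative hε (fun k => g k x) (fun k => pd (g k) j x)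
    fun k => pd (pd (g k) j) j x

lemma rpow_neg_mul_abs_le (hε : 0 < ε) (a : Fin 3 → ℝ) (i : Fin 3) :
    ((∑ k, a k ^ 2) + ε) ^ (-(1 / 4) : ℝ) * |a i| ≤ ((∑ k, a k ^ 2) + ε) ^ (1 / 4 : ℝ) := by
  have hX := sum_sq_add_pos hε a
  have h1 : a i ^ 2 ≤ (∑ k, a k ^ 2) + ε :=
    (Finset.single_le_sum (f := fun k => a k ^ 2) (fun k _ => sq_nonneg _)
      (Finset.mem_univ i)).trans (by linarith)
  have h2 : |a i| ≤ ((∑ k, a k ^ 2) + ε) ^ (1 / 2 : ℝ) := by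
    rw [← Real.sqrt_eq_rpow]
    exact Real.abs_le_sqrt h1
  calc _ ≤ ((∑ k, a k ^ 2) + ε) ^ (-(1 / 4) : ℝ) * ((∑ k, a k ^ 2) + ε) ^ (1 / 2 : ℝ) := by gcongr
    _ = _ := by rw [← Real.rpow_add hX]; norm_num

/-- Pointwise bound for the lower order terms of the equation tested against
`(|u|² + ε)^(-1/4) u`. -/
lemma lower_order_le (hε : 0 < ε) (a : Fin 3 → ℝ) (d : Fin 3 → Fin 3 → ℝ) (q : Fin 3 → ℝ) :
    3 / 2 * ((∑ k, a k ^ 2) + ε) ^ (-(1 / 4) : ℝ) * ∑ i, a i * (-(∑ j, a j * d i j) - q i) ≤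
      9 / 4 * ∑ j, ((∑ k, a k ^ 2) + ε) ^ (1 / 2 : ℝ) * a j ^ 2 + 3 / 4 * ∑ i, ∑ j, d i j ^ 2
        + 3 / 2 * ∑ i, ((∑ k, a k ^ 2) + ε) ^ (1 / 4 : ℝ) * |q i| := by
  have hX := sum_sq_add_pos hε a
  have hle := rpow_neg_mul_abs_le hε a
  set X := (∑ k, a k ^ 2) + ε with hXdef
  set c := X ^ (-(1 / 4) : ℝ)
  set b := X ^ (1 / 4 : ℝ)
  have hb : 0 < b := by positivity
  have hb2 : X ^ (1 / 2 : ℝ) = b ^ 2 := by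
    rw [← Real.rpow_natCast, ← Real.rpow_mul hX.le]
    norm_num
  have h1 : ∀ i, c * (a i * (-(∑ j, a j * d i j) - q i)) ≤
      ∑ j, (1 / 2) * (b ^ 2 * a j ^ 2 + d i j ^ 2) + b * |q i| := by
    intro i
    have h2 : c * (a i * (-(∑ j, a j * d i j) - q i)) ≤ b * (∑ j, |a j| * |d i j| + |q i|) := by
      calc _ = (c * a i) * (-(∑ j, a j * d i j) - q i) := by ring
        _ ≤ |(c * a i) * (-(∑ j, a j * d i j) - q i)| := le_abs_self _
        _ = (c * |a i|) * |-(∑ j, a j * d i j) - q i| := by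
            rw [abs_mul, abs_mul, abs_of_pos (by positivity : 0 < c)]
        _ ≤ b * (∑ j, |a j| * |d i j| + |q i|) := by
            gcongr
            · exact hle i
            · refine (abs_sub _ _).trans ?_
              rw [abs_neg]
              gcongr
              refine (Finset.abs_sum_le_sum_abs _ _).trans (le_of_eq ?_)
              simp_rw [abs_mul]
    refine h2.trans ?_
    rw [mul_add, Finset.mul_sum]
    refine add_le_add (Finset.sum_le_sum fun j _ => ?_) le_rfl
    have := sq_nonneg (b * |a j| - |d i j|)
    have e1 := sq_abs (a j)
    have e2 := sq_abs (d i j)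
    nlinarith
  calc _ = 3 / 2 * ∑ i, c * (a i * (-(∑ j, a j * d i j) - q i)) := by rw [← Finset.mul_sum]; ring
    _ ≤ 3 / 2 * ∑ i, (∑ j, (1 / 2) * (b ^ 2 * a j ^ 2 + d i j ^ 2) + b * |q i|) := by
        gcongr with i
        exact h1 i
    _ = _ := by
        rw [hb2]
        simp only [Fin.sum_univ_three]
        ring

end Power

/-! ### Spatial estimates at a fixed time -/

lemma exists_abs_integral_mul_le {χ : E3 → ℝ} {R : ℝ} (hχ : Continuous χ)
    (hsupp : tsupport χ ⊆ ball (0:E3) R) (hR : R < 2) :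
    ∃ M > 0, ∀ f : E3 → ℝ, ContinuousOn f (ball 0 2) →
      |∫ x, χ x * f x| ≤ M * ∫ x in ball (0:E3) R, |f x| := by
  obtain ⟨M, hM⟩ := (hasCompactSupport_of_tsupport_subset_ball hsupp).exists_bound_of_continuous hχ
  refine ⟨|M| + 1, by positivity, fun f hf => ?_⟩
  have hi := integrableOn_ball_of_continuousOn hR hf.abs
  have h0 : ∫ x, χ x * f x = ∫ x in ball (0:E3) R, χ x * f x := by
    refine (setIntegral_eq_integral_of_forall_compl_eq_zero fun x hx => ?_).symm
    rw [image_eq_zero_of_notMem_tsupport fun h => hx (hsupp h), zero_mul]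
  rw [h0, ← integral_const_mul]
  refine (abs_integral_le_integral_abs).trans (integral_mono_of_nonneg
    (ae_of_all _ fun x => abs_nonneg _) (hi.const_mul _) (ae_of_all _ fun x => ?_))
  simp only [abs_mul]
  gcongr
  have h1 := hM x
  rw [Real.norm_eq_abs] at h1
  linarith [le_abs_self M]

lemma integral_mul_mul_le_rpow {ψ : E3 → ℝ} {r p q : ℝ} (hψ : Continuous ψ)
    (hψ0 : ∀ x, 0 ≤ ψ x) (hψ1 : ∀ x, ψ x ≤ 1) (hsupp : tsupport ψ ⊆ ball (0:E3) r) (hr : r < 2)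
    (hpq : p.HolderConjugate q) {f g : E3 → ℝ} (hf : ContinuousOn f (ball 0 2))
    (hg : ContinuousOn g (ball 0 2)) (hf0 : ∀ x, 0 ≤ f x) (hg0 : ∀ x, 0 ≤ g x) :
    ∫ x, ψ x * (f x * g x) ≤
      (∫ x, ψ x * f x ^ p) ^ (1 / p) * (∫ x in ball (0:E3) r, g x ^ q) ^ (1 / q) := by
  have hmem : ∀ {k : E3 → ℝ} {e : ℝ}, ContinuousOn k (ball 0 2) →
      MemLp k (ENNReal.ofReal e) (volume.restrict (ball (0:E3) r)) := by
    intro k e hk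
    obtain ⟨M, hM⟩ := (isCompact_closedBall (0:E3) r).exists_bound_of_continuousOn
      (hk.mono (closedBall_subset_ball hr))
    have : IsFiniteMeasure (volume.restrict (ball (0:E3) r)) :=
      ⟨by rw [Measure.restrict_apply_univ]; exact measure_ball_lt_top⟩
    refine MemLp.of_bound ((hk.mono (ball_subset_ball hr.le)).aestronglyMeasurable
      measurableSet_ball) M ?_
    filter_upwards [ae_restrict_mem measurableSet_ball] with x hx using
      hM x (ball_subset_closedBall hx)
  have h0 : ∫ x, ψ x * (f x * g x) = ∫ x in ball (0:E3) r, (ψ x * f x) * g x := by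
    simp_rw [← mul_assoc]
    refine (setIntegral_eq_integral_of_forall_compl_eq_zero fun x hx => ?_).symm
    rw [image_eq_zero_of_notMem_tsupport fun h => hx (hsupp h), zero_mul, zero_mul]
  rw [h0]
  refine (integral_mul_le_Lp_mul_Lq_of_nonneg hpq (ae_of_all _ fun x => mul_nonneg (hψ0 x) (hf0 x))
    (ae_of_all _ hg0) (hmem (hψ.continuousOn.mul hf)) (hmem hg)).trans ?_
  have hfp : ContinuousOn (fun x => f x ^ p) (ball 0 2) :=
    hf.rpow_const fun x _ => Or.inr hpq.nonneg
  have h1 : ∫ x in ball (0:E3) r, (ψ x * f x) ^ p ≤ ∫ x, ψ x * f x ^ p := by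
    have h2 : ∫ x, ψ x * f x ^ p = ∫ x in ball (0:E3) r, ψ x * f x ^ p := by
      refine (setIntegral_eq_integral_of_forall_compl_eq_zero fun x hx => ?_).symm
      rw [image_eq_zero_of_notMem_tsupport fun h => hx (hsupp h), zero_mul]
    rw [h2]
    refine integral_mono_of_nonneg
      (ae_of_all _ fun x => Real.rpow_nonneg (mul_nonneg (hψ0 x) (hf0 x)) _)
      (integrableOn_ball_of_continuousOn hr (hψ.continuousOn.mul hfp)) (ae_of_all _ fun x => ?_)
    simp only [Real.mul_rpow (hψ0 x) (hf0 x)]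
    refine mul_le_mul_of_nonneg_right ?_ (Real.rpow_nonneg (hf0 x) _)
    exact Real.rpow_le_self_of_le_one (hψ0 x) (hψ1 x) hpq.lt.le
  gcongr
  · exact Real.rpow_nonneg (setIntegral_nonneg measurableSet_ball fun x _ =>
      Real.rpow_nonneg (hg0 x) _) _
  · exact setIntegral_nonneg measurableSet_ball fun x _ =>
      Real.rpow_nonneg (mul_nonneg (hψ0 x) (hf0 x)) _
  · exact hpq.one_div_nonneg

lemma rpow_three_quarters_le {s X : ℝ} (hs : 0 < s) (hs1 : s ≤ 1) (hX : s ^ 2 ≤ X) :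
    X ^ (3 / 4 : ℝ) ≤ s⁻¹ * X := by
  have hX0 : 0 < X := lt_of_lt_of_le (by positivity) hX
  have h1 : X ^ (3 / 4 : ℝ) = X ^ (-(1 / 4) : ℝ) * X := by
    rw [← Real.rpow_add_one hX0.ne']
    norm_num
  rw [h1]
  gcongr
  calc X ^ (-(1 / 4) : ℝ) ≤ (s ^ 2) ^ (-(1 / 4) : ℝ) :=
        Real.rpow_le_rpow_of_nonpos (by positivity) hX (by norm_num)
    _ = s ^ (-(1 / 2) : ℝ) := by
        rw [← Real.rpow_natCast, ← Real.rpow_mul hs.le]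
        norm_num
    _ ≤ s ^ (-1 : ℝ) := Real.rpow_le_rpow_of_exponent_ge hs hs1 (by norm_num)
    _ = s⁻¹ := Real.rpow_neg_one s

lemma abs_le_add_inv_mul_sq {s : ℝ} (hs : 0 < s) (a : ℝ) : |a| ≤ s + s⁻¹ * a ^ 2 := by
  have h := sq_nonneg (s - |a|)
  have e : s⁻¹ * a ^ 2 * s = a ^ 2 := by field_simp
  have e2 := sq_abs a
  have : |a| * s ≤ (s + s⁻¹ * a ^ 2) * s := by
    rw [add_mul, e]
    nlinarith [abs_nonneg a]
  exact le_of_mul_le_mul_right this hs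

lemma rpow_le_one_add {y p : ℝ} (hy : 0 ≤ y) (hp0 : 0 ≤ p) (hp : p ≤ 1) : y ^ p ≤ 1 + y := by
  rcases le_total y 1 with h | h
  · linarith [Real.rpow_le_one hy h hp0]
  · have := Real.rpow_le_rpow_of_exponent_le h hp
    rw [Real.rpow_one] at this
    linarith

lemma exists_integral_sum_sq_add_le {φ : E3 → ℝ} (hφs : Continuous φ) (hφ0 : ∀ x, 0 ≤ φ x)
    {R : ℝ} (hR0 : 0 < R) (hR : R < 2) (hφsupp : tsupport φ ⊆ ball (0:E3) R)
    (hφint : ∫ x : E3, φ x = 1) :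
    ∃ K > 0, ∀ (ε : ℝ) (g : Fin 3 → E3 → ℝ), 0 ≤ ε →
      (∀ i, ContDiffOn ℝ (⊤ : ℕ∞) (g i) (ball 0 2)) → (∀ i, ∫ x, φ x * g i x = 0) →
      ∫ x in ball (0:E3) R, ((∑ k, g k x ^ 2) + ε) ≤
        K * ((∫ x in ball (0:E3) R, ∑ i, ∑ j, pd (g i) j x ^ 2) + ε) := by
  obtain ⟨K, hK, h⟩ := exists_integral_sq_le φ hφs hφ0 hR0 hR hφsupp hφint
  refine ⟨K + volume.real (ball (0:E3) R), by positivity, fun ε g hε hg hg0 => ?_⟩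
  have hi1 : ∀ i, IntegrableOn (fun x => g i x ^ 2) (ball (0:E3) R) := fun i =>
    integrableOn_ball_of_continuousOn hR ((hg i).continuousOn.pow 2)
  have hi2 : ∀ i, IntegrableOn (fun x => ∑ j, pd (g i) j x ^ 2) (ball (0:E3) R) := fun i =>
    integrableOn_ball_of_continuousOn hR
      (continuousOn_finsetSum _ fun j _ => (contDiffOn_pd (hg i) j).continuousOn.pow 2)
  have hic : IntegrableOn (fun _ => ε) (ball (0:E3) R) :=
    integrableOn_const (by exact measure_ball_lt_top.ne)
  rw [integral_add (integrable_finsetSum _ fun i _ => hi1 i) hic,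
    integral_finsetSum _ fun i _ => hi1 i, integral_finsetSum _ fun i _ => hi2 i,
    setIntegral_const, smul_eq_mul]
  have h1 : ∑ i, ∫ x in ball (0:E3) R, g i x ^ 2 ≤
      K * ∑ i, ∫ x in ball (0:E3) R, ∑ j, pd (g i) j x ^ 2 := by
    rw [Finset.mul_sum]
    exact Finset.sum_le_sum fun i _ => h (g i) ((hg i).of_le (by simp)) (hg0 i)
  have h2 : 0 ≤ ∑ i, ∫ x in ball (0:E3) R, ∑ j, pd (g i) j x ^ 2 :=
    Finset.sum_nonneg fun i _ => setIntegral_nonneg measurableSet_ball fun x _ =>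
      Finset.sum_nonneg fun j _ => sq_nonneg _
  have h3 : 0 ≤ volume.real (ball (0:E3) R) := measureReal_nonneg
  nlinarith [mul_nonneg h3 h2, mul_nonneg hK.le hε]

/-- Bound for the mean of the pressure gradient, obtained by testing the equation with `φ`. -/
lemma exists_abs_integral_mul_pd_pressure_le {φ : E3 → ℝ} (hφs : ContDiff ℝ (⊤ : ℕ∞) φ)
    (hφ0 : ∀ x, 0 ≤ φ x) {R : ℝ} (hR0 : 0 < R) (hR : R < 2) (hφsupp : tsupport φ ⊆ ball (0:E3) R)
    (hφint : ∫ x : E3, φ x = 1) :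
    ∃ K > 0, ∀ (s : ℝ) (g a : Fin 3 → E3 → ℝ) (p : E3 → ℝ), 0 < s → s ≤ 1 →
      (∀ i, ContDiffOn ℝ (⊤ : ℕ∞) (g i) (ball 0 2)) →
      (∀ i, ContDiffOn ℝ (⊤ : ℕ∞) (a i) (ball 0 2)) →
      (∀ i, ∫ x, φ x * g i x = 0) → (∀ i, ∫ x, φ x * a i x = 0) →
      (∀ x ∈ ball (0:E3) 2, ∀ i, a i x + (∑ j, g j x * pd (g i) j x) + pd p i x
        - ∑ j, pd (pd (g i) j) j x = 0) →
      ∀ i, |∫ x, φ x * pd p i x| ≤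
        K * (s⁻¹ * (∫ x in ball (0:E3) R, ∑ i, ∑ j, pd (g i) j x ^ 2) + s) := by
  obtain ⟨K, hK, hX⟩ := exists_integral_sum_sq_add_le hφs.continuous hφ0 hR0 hR hφsupp hφint
  obtain ⟨M, hM, hφM⟩ := exists_abs_integral_mul_le hφs.continuous hφsupp hR
  have hsupp2 := hφsupp.trans (ball_subset_ball hR.le)
  choose N hN hφN using fun j => exists_abs_integral_mul_le
    (contDiff_pd (contDiff_pd hφs j) j).continuous
    ((tsupport_pd_subset _ j).trans ((tsupport_pd_subset φ j).trans hφsupp)) hR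
  refine ⟨(∑ j, N j) * (volume.real (ball (0:E3) R) + K) + M * (K + 1), ?_,
    fun s g a p hs hs1 hg ha hg0 ha0 heq i => ?_⟩
  · have : 0 ≤ ∑ j, N j := Finset.sum_nonneg fun j _ => (hN j).le
    positivity
  set A := ∫ x in ball (0:E3) R, ∑ i, ∑ j, pd (g i) j x ^ 2 with hA
  have hA0 : 0 ≤ A := setIntegral_nonneg measurableSet_ball fun x _ =>
    Finset.sum_nonneg fun i _ => Finset.sum_nonneg fun j _ => sq_nonneg _
  have hX0 := hX 0 g le_rfl hg hg0
  simp only [add_zero] at hX0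
  have hc : ∀ i, ContinuousOn (g i) (ball (0:E3) 2) := fun i => (hg i).continuousOn
  have hdc : ∀ i j, ContinuousOn (pd (g i) j) (ball (0:E3) 2) :=
    fun i j => (contDiffOn_pd (hg i) j).continuousOn
  have hddc : ∀ i j, ContinuousOn (pd (pd (g i) j) j) (ball (0:E3) 2) :=
    fun i j => (contDiffOn_pd (contDiffOn_pd (hg i) j) j).continuousOn
  have hnc : ContinuousOn (fun x => ∑ j, g j x * pd (g i) j x) (ball (0:E3) 2) :=
    continuousOn_finsetSum _ fun j _ => (hc j).mul (hdc i j)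
  have h_integrable : ∀ {f : E3 → ℝ}, ContinuousOn f (ball (0:E3) 2) → Integrable fun x => φ x * f x :=
    fun hf => integrable_mul_of_tsupport_subset hφs.continuous hsupp2 hf
  have hson : ∀ {f : E3 → ℝ}, ContinuousOn f (ball (0:E3) 2) → IntegrableOn f (ball 0 R) :=
    fun hf => integrableOn_ball_of_continuousOn hR hf
  have h1 : ∫ x, φ x * pd p i x = ∑ j, (∫ x, pd (pd φ j) j x * g i x)
      - ∫ x, φ x * ∑ j, g j x * pd (g i) j x := by
    have h2 : ∀ x, φ x * pd p i x = ∑ j, φ x * pd (pd (g i) j) j x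
        - φ x * (∑ j, g j x * pd (g i) j x) - φ x * a i x := by
      intro x
      by_cases hx : x ∈ tsupport φ
      · have h3 : pd p i x = ∑ j, pd (pd (g i) j) j x - (∑ j, g j x * pd (g i) j x) - a i x := by
          linarith [heq x (hsupp2 hx) i]
        rw [h3, ← Finset.mul_sum]
        ring
      · simp [image_eq_zero_of_notMem_tsupport hx]
    simp_rw [h2]
    have hi1 : Integrable fun x => ∑ j, φ x * pd (pd (g i) j) j x :=
      integrable_finsetSum _ fun j _ => h_integrable (hddc i j)
    have hi2 : Integrable fun x =>
        ∑ j, φ x * pd (pd (g i) j) j x - φ x * ∑ j, g j x * pd (g i) j x := hi1.sub (h_integrable hnc)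
    rw [integral_sub hi2 (h_integrable (ha i).continuousOn), integral_sub hi1 (h_integrable hnc), ha0 i, sub_zero,
      integral_finsetSum _ fun j _ => h_integrable (hddc i j)]
    simp_rw [integral_mul_pd_pd hφs hsupp2 (hg i)]
  have hinvs : 0 < s⁻¹ := inv_pos.2 hs
  have h1s : 1 ≤ s⁻¹ := (one_le_inv₀ hs).2 hs1
  have hAs : A ≤ s⁻¹ * A := le_mul_of_one_le_left hA0 h1s
  have hsum : ContinuousOn (fun x => ∑ k, g k x ^ 2) (ball (0:E3) 2) :=
    continuousOn_finsetSum _ fun k _ => (hc k).pow 2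
  have hsumd : ContinuousOn (fun x => ∑ i, ∑ j, pd (g i) j x ^ 2) (ball (0:E3) 2) :=
    continuousOn_finsetSum _ fun k _ => continuousOn_finsetSum _ fun j _ => (hdc k j).pow 2
  have hle : ∀ x k, g k x ^ 2 ≤ ∑ k, g k x ^ 2 := fun x k =>
    Finset.single_le_sum (f := fun k => g k x ^ 2) (fun k _ => sq_nonneg _) (Finset.mem_univ k)
  have hic : IntegrableOn (fun _ => s) (ball (0:E3) R) :=
    integrableOn_const (by exact measure_ball_lt_top.ne)
  have hgi : ∫ x in ball (0:E3) R, |g i x| ≤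
      volume.real (ball (0:E3) R) * s + s⁻¹ * (K * A) := by
    calc ∫ x in ball (0:E3) R, |g i x|
        ≤ ∫ x in ball (0:E3) R, (s + s⁻¹ * ∑ k, g k x ^ 2) := by
          refine integral_mono (hson (hc i).abs) (hic.add ((hson hsum).const_mul _)) fun x => ?_
          refine (abs_le_add_inv_mul_sq hs _).trans ?_
          gcongr
          exact hle x i
      _ ≤ _ := by
          rw [integral_add hic ((hson hsum).const_mul _), setIntegral_const, smul_eq_mul,
            integral_const_mul]
          gcongr
  have hni : ∫ x in ball (0:E3) R, |∑ j, g j x * pd (g i) j x| ≤ (K + 1) * A := by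
    calc ∫ x in ball (0:E3) R, |∑ j, g j x * pd (g i) j x|
        ≤ ∫ x in ball (0:E3) R, ((∑ k, g k x ^ 2) + ∑ i, ∑ j, pd (g i) j x ^ 2) := by
          refine integral_mono (hson hnc.abs) ((hson hsum).add (hson hsumd)) fun x => ?_
          refine (Finset.abs_sum_le_sum_abs _ _).trans ?_
          calc ∑ j, |g j x * pd (g i) j x| ≤ ∑ j, (g j x ^ 2 + pd (g i) j x ^ 2) := by
                refine Finset.sum_le_sum fun j _ => ?_
                rw [abs_mul, ← sq_abs (g j x), ← sq_abs (pd (g i) j x)]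
                nlinarith [sq_nonneg (|g j x| - |pd (g i) j x|), sq_nonneg (g j x),
                  sq_nonneg (|g j x|), sq_nonneg (|pd (g i) j x|)]
            _ ≤ _ := by
                rw [Finset.sum_add_distrib]
                refine add_le_add le_rfl ?_
                exact Finset.single_le_sum (f := fun i => ∑ j, pd (g i) j x ^ 2)
                  (fun i _ => Finset.sum_nonneg fun j _ => sq_nonneg _) (Finset.mem_univ i)
      _ ≤ _ := by
          rw [integral_add (hson hsum) (hson hsumd)]
          linarith
  rw [h1]
  have hS : 0 ≤ ∑ j, N j := Finset.sum_nonneg fun j _ => (hN j).le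
  have hV : 0 ≤ volume.real (ball (0:E3) R) := measureReal_nonneg
  calc |∑ j, (∫ x, pd (pd φ j) j x * g i x) - ∫ x, φ x * ∑ j, g j x * pd (g i) j x|
      ≤ ∑ j, N j * (volume.real (ball (0:E3) R) * s + s⁻¹ * (K * A)) + M * ((K + 1) * A) := by
        refine (abs_sub _ _).trans (add_le_add ((Finset.abs_sum_le_sum_abs _ _).trans
          (Finset.sum_le_sum fun j _ => ?_)) ?_)
        · exact (hφN j _ (hc i)).trans (mul_le_mul_of_nonneg_left hgi (hN j).le)
        · exact (hφM _ hnc).trans (mul_le_mul_of_nonneg_left hni hM.le)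
    _ ≤ (∑ j, N j) * ((volume.real (ball (0:E3) R) + K) * (s⁻¹ * A + s))
          + M * ((K + 1) * (s⁻¹ * A + s)) := by
        rw [← Finset.sum_mul]
        gcongr
        · have e1 : 0 ≤ volume.real (ball (0:E3) R) * (s⁻¹ * A) := by positivity
          have e2 : 0 ≤ K * s := by positivity
          linarith
        · linarith
    _ = _ := by ring

lemma exists_integral_mul_pd_pd_rpow_le {φ ψ : E3 → ℝ} (hφs : Continuous φ) (hφ0 : ∀ x, 0 ≤ φ x)
    {R : ℝ} (hR0 : 0 < R) (hR : R < 2) (hφsupp : tsupport φ ⊆ ball (0:E3) R)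
    (hφint : ∫ x : E3, φ x = 1) (hψ : ContDiff ℝ (⊤ : ℕ∞) ψ)
    (hψsupp : tsupport ψ ⊆ ball (0:E3) R) :
    ∃ K > 0, ∀ (s : ℝ) (g : Fin 3 → E3 → ℝ), 0 < s → s ≤ 1 →
      (∀ i, ContDiffOn ℝ (⊤ : ℕ∞) (g i) (ball 0 2)) → (∀ i, ∫ x, φ x * g i x = 0) →
      ∀ j, ∫ x, ψ x * pd (pd (fun x => ((∑ k, g k x ^ 2) + s ^ 2) ^ (3 / 4 : ℝ)) j) j x ≤
        K * (s⁻¹ * (∫ x in ball (0:E3) R, ∑ i, ∑ j, pd (g i) j x ^ 2) + s) := by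
  obtain ⟨K, hK, hX⟩ := exists_integral_sum_sq_add_le hφs hφ0 hR0 hR hφsupp hφint
  have hsupp2 := hψsupp.trans (ball_subset_ball hR.le)
  choose N hN hψN using fun j => exists_abs_integral_mul_le
    (contDiff_pd (contDiff_pd hψ j) j).continuous
    ((tsupport_pd_subset _ j).trans ((tsupport_pd_subset ψ j).trans hψsupp)) hR
  refine ⟨(∑ j, N j) * K, mul_pos (Finset.sum_pos (fun j _ => hN j) Finset.univ_nonempty) hK,
    fun s g hs hs1 hg hg0 j => ?_⟩
  have hW := contDiffOn_rpow_sum_sq (pow_pos hs 2) hg (3 / 4)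
  have hXc : ContinuousOn (fun x => (∑ k, g k x ^ 2) + s ^ 2) (ball (0:E3) 2) :=
    (continuousOn_finsetSum _ fun k _ => (hg k).continuousOn.pow 2).add continuousOn_const
  have hX' := hX (s ^ 2) g (sq_nonneg s) hg hg0
  set A := ∫ x in ball (0:E3) R, ∑ i, ∑ j, pd (g i) j x ^ 2
  have hNj : N j ≤ ∑ j, N j := Finset.single_le_sum (fun j _ => (hN j).le) (Finset.mem_univ j)
  have hinvs : 0 < s⁻¹ := inv_pos.2 hs
  rw [integral_mul_pd_pd hψ hsupp2 hW]
  calc _ ≤ N j * ∫ x in ball (0:E3) R, |((∑ k, g k x ^ 2) + s ^ 2) ^ (3 / 4 : ℝ)| :=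
        (le_abs_self _).trans (hψN j _ hW.continuousOn)
    _ ≤ N j * ∫ x in ball (0:E3) R, s⁻¹ * ((∑ k, g k x ^ 2) + s ^ 2) := by
        refine mul_le_mul_of_nonneg_left (integral_mono
          (integrableOn_ball_of_continuousOn hR hW.continuousOn.abs)
          ((integrableOn_ball_of_continuousOn hR hXc).const_mul _) fun x => ?_) (hN j).le
        have hpos := sum_sq_add_pos (pow_pos hs 2) fun k => g k x
        simp only
        rw [abs_of_nonneg (Real.rpow_nonneg hpos.le _)]
        refine rpow_three_quarters_le hs hs1 ?_
        have : 0 ≤ ∑ k, g k x ^ 2 := Finset.sum_nonneg fun _ _ => sq_nonneg _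
        linarith
    _ ≤ N j * (s⁻¹ * (K * (A + s ^ 2))) := by
        rw [integral_const_mul]
        have := (hN j).le
        gcongr
    _ = N j * (K * (s⁻¹ * A + s)) := by field_simp
    _ ≤ (∑ j, N j) * (K * (s⁻¹ * A + s)) := by
        have hA0 : 0 ≤ A := setIntegral_nonneg measurableSet_ball fun x _ =>
          Finset.sum_nonneg fun i _ => Finset.sum_nonneg fun j _ => sq_nonneg _
        gcongr
    _ = _ := by ring

/-- The differential inequality for the localized `L^{3/2}` energy, at a fixed time: `g` is the
velocity, `a` its time derivative and `p` the pressure. -/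
lemma exists_integral_time_derivative_le {φ ψ : E3 → ℝ} (hφs : ContDiff ℝ (⊤ : ℕ∞) φ)
    (hφ0 : ∀ x, 0 ≤ φ x) {r R : ℝ} (hr : 0 < r) (hrR : r < R) (hR : R < 2)
    (hφsupp : tsupport φ ⊆ ball (0:E3) R) (hφint : ∫ x : E3, φ x = 1)
    (hψ : ContDiff ℝ (⊤ : ℕ∞) ψ) (hψ0 : ∀ x, 0 ≤ ψ x) (hψ1 : ∀ x, ψ x ≤ 1)
    (hψsupp : tsupport ψ ⊆ ball (0:E3) r) :
    ∃ K > 0, ∀ (s : ℝ) (g a : Fin 3 → E3 → ℝ) (p : E3 → ℝ), 0 < s → s ≤ 1 →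
      (∀ i, ContDiffOn ℝ (⊤ : ℕ∞) (g i) (ball 0 2)) →
      (∀ i, ContDiffOn ℝ (⊤ : ℕ∞) (a i) (ball 0 2)) →
      ContDiffOn ℝ (⊤ : ℕ∞) p (ball 0 2) →
      (∀ i, ∫ x, φ x * g i x = 0) → (∀ i, ∫ x, φ x * a i x = 0) →
      (∀ x ∈ ball (0:E3) 2, ∀ i, a i x + (∑ j, g j x * pd (g i) j x) + pd p i x
        - ∑ j, pd (pd (g i) j) j x = 0) →
      ∫ x, ψ x * (3 / 2 * ((∑ k, g k x ^ 2) + s ^ 2) ^ (-(1 / 4) : ℝ) * ∑ k, g k x * a k x) ≤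
        K * (1 + ∫ x, ψ x * ((∑ k, g k x ^ 2) + s ^ 2) ^ (3 / 4 : ℝ)) *
          ((∫ x in ball (0:E3) R, ∑ i, ∑ j, |pd (pd p i) j x|)
            + s⁻¹ * (∫ x in ball (0:E3) R, ∑ i, ∑ j, pd (g i) j x ^ 2) + s) := by
  have hR0 := hr.trans hrR
  have hψR := hψsupp.trans (ball_subset_ball hrR.le)
  have hψ2 := hψR.trans (ball_subset_ball hR.le)
  obtain ⟨K₁, hK₁, h₁⟩ := exists_integral_mul_pd_pd_rpow_le hφs.continuous hφ0 hR0 hR hφsupp hφint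
    hψ hψR
  obtain ⟨K₂, hK₂, h₂⟩ := exists_integral_pow_six_le φ hφs.continuous hφ0 hr hrR hR hφsupp hφint
  obtain ⟨K₃, hK₃, h₃⟩ := exists_integral_rpow_three_halves_le φ hφs.continuous hφ0 hr hrR hR
    hφsupp hφint
  obtain ⟨K₄, hK₄, h₄⟩ := exists_abs_integral_mul_pd_pressure_le hφs hφ0 hR0 hR hφsupp hφint
  refine ⟨3 * K₁ + 9 / 4 * K₂ + 3 / 4 + 3 / 2 * (K₃ * (1 + 3 * K₄)), by positivity,
    fun s g a p hs hs1 hg ha hp hg0 ha0 heq => ?_⟩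
  have hs2 : 0 < s ^ 2 := pow_pos hs 2
  have hW := contDiffOn_rpow_sum_sq hs2 hg (3 / 4)
  have h1g := h₁ s g hs hs1 hg hg0
  have h2g := fun i => h₂ (g i) ((hg i).of_le (by simp)) (hg0 i)
  have h3p := fun i => h₃ (pd p i) ((contDiffOn_pd hp i).of_le (by simp))
  have h4p := h₄ s g a p hs hs1 hg ha hg0 ha0 heq
  have hc : ∀ i, ContinuousOn (g i) (ball (0:E3) 2) := fun i => (hg i).continuousOn
  have hXc : ∀ e : ℝ, ContinuousOn (fun x => ((∑ k, g k x ^ 2) + s ^ 2) ^ e) (ball (0:E3) 2) :=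
    fun e => (contDiffOn_rpow_sum_sq hs2 hg e).continuousOn
  have hpc : ∀ i, ContinuousOn (pd p i) (ball (0:E3) 2) := fun i => (contDiffOn_pd hp i).continuousOn
  have hppc : ∀ i j, ContinuousOn (pd (pd p i) j) (ball (0:E3) 2) :=
    fun i j => (contDiffOn_pd (contDiffOn_pd hp i) j).continuousOn
  have hdc : ∀ i j, ContinuousOn (pd (g i) j) (ball (0:E3) 2) :=
    fun i j => (contDiffOn_pd (hg i) j).continuousOn
  have hWc : ∀ j, ContinuousOn
      (pd (pd (fun x => ((∑ k, g k x ^ 2) + s ^ 2) ^ (3 / 4 : ℝ)) j) j) (ball (0:E3) 2) :=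
    fun j => (contDiffOn_pd (contDiffOn_pd hW j) j).continuousOn
  have hXpos : ∀ x, 0 < (∑ k, g k x ^ 2) + s ^ 2 := fun x => sum_sq_add_pos hs2 fun k => g k x
  have h_integrable : ∀ {f : E3 → ℝ}, ContinuousOn f (ball (0:E3) 2) → Integrable fun x => ψ x * f x :=
    fun hf => integrable_mul_of_tsupport_subset hψ.continuous hψ2 hf
  have hson : ∀ {f : E3 → ℝ}, ContinuousOn f (ball (0:E3) 2) → IntegrableOn f (ball 0 R) :=
    fun hf => integrableOn_ball_of_continuousOn hR hf
  set y := ∫ x, ψ x * ((∑ k, g k x ^ 2) + s ^ 2) ^ (3 / 4 : ℝ) with hy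
  have hy0 : 0 ≤ y :=
    integral_nonneg fun x => mul_nonneg (hψ0 x) (Real.rpow_nonneg (hXpos x).le _)
  set A := ∫ x in ball (0:E3) R, ∑ i, ∑ j, pd (g i) j x ^ 2 with hA
  have hAsum : A = ∑ i, ∫ x in ball (0:E3) R, ∑ j, pd (g i) j x ^ 2 :=
    integral_finsetSum _ fun i _ => hson (continuousOn_finsetSum _ fun j _ => (hdc i j).pow 2)
  set D := ∫ x in ball (0:E3) R, ∑ i, ∑ j, |pd (pd p i) j x| with hD
  have hDsum : D = ∑ i, ∫ x in ball (0:E3) R, ∑ j, |pd (pd p i) j x| :=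
    integral_finsetSum _ fun i _ => hson (continuousOn_finsetSum _ fun j _ => (hppc i j).abs)
  have hA0 : 0 ≤ A := setIntegral_nonneg measurableSet_ball fun x _ =>
    Finset.sum_nonneg fun i _ => Finset.sum_nonneg fun j _ => sq_nonneg _
  have hD0 : 0 ≤ D := setIntegral_nonneg measurableSet_ball fun x _ =>
    Finset.sum_nonneg fun i _ => Finset.sum_nonneg fun j _ => abs_nonneg _
  have h1s : 1 ≤ s⁻¹ := (one_le_inv₀ hs).2 hs1
  have hAs : A ≤ s⁻¹ * A := le_mul_of_one_le_left hA0 h1s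
  have hconv : ∀ i, ∫ x, ψ x * (((∑ k, g k x ^ 2) + s ^ 2) ^ (1 / 2 : ℝ) * g i x ^ 2) ≤
      (1 + y) * (K₂ * ∫ x in ball (0:E3) R, ∑ j, pd (g i) j x ^ 2) := by
    intro i
    have h := integral_mul_mul_le_rpow hψ.continuous hψ0 hψ1 hψsupp (hrR.trans hR)
      (p := 3 / 2) (q := 3) (by rw [Real.holderConjugate_iff]; norm_num)
      (hXc (1 / 2)) ((hc i).pow 2) (fun x => Real.rpow_nonneg (hXpos x).le _) fun x => sq_nonneg _
    simp only [← Real.rpow_mul (hXpos _).le] at h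
    norm_num only at h
    rw [← hy] at h
    refine h.trans ?_
    refine mul_le_mul (rpow_le_one_add hy0 (by norm_num) (by norm_num)) (h2g i) ?_ (by positivity)
    exact Real.rpow_nonneg (setIntegral_nonneg measurableSet_ball fun x _ =>
      Real.rpow_nonneg (sq_nonneg _) _) _
  have hpres : ∀ i, ∫ x, ψ x * (((∑ k, g k x ^ 2) + s ^ 2) ^ (1 / 4 : ℝ) * |pd p i x|) ≤
      (1 + y) * (K₃ * ((∫ x in ball (0:E3) R, ∑ j, |pd (pd p i) j x|)
        + K₄ * (s⁻¹ * A + s))) := by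
    intro i
    have h := integral_mul_mul_le_rpow hψ.continuous hψ0 hψ1 hψsupp (hrR.trans hR)
      (p := 3) (q := 3 / 2) (by rw [Real.holderConjugate_iff]; norm_num)
      (hXc (1 / 4)) (hpc i).abs (fun x => Real.rpow_nonneg (hXpos x).le _) fun x => abs_nonneg _
    simp only [← Real.rpow_mul (hXpos _).le] at h
    norm_num only at h
    rw [← hy] at h
    refine h.trans ?_
    refine mul_le_mul (rpow_le_one_add hy0 (by norm_num) (by norm_num)) ?_ ?_ (by positivity)
    · have := h3p i
      norm_num only at this
      refine this.trans ?_
      gcongr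
      exact h4p i
    · exact Real.rpow_nonneg (setIntegral_nonneg measurableSet_ball fun x _ =>
        Real.rpow_nonneg (abs_nonneg _) _) _
  have hdiss : ∫ x, ψ x * (∑ i, ∑ j, pd (g i) j x ^ 2) ≤ A := by
    have hcd : ContinuousOn (fun x => ∑ i, ∑ j, pd (g i) j x ^ 2) (ball (0:E3) 2) :=
      continuousOn_finsetSum _ fun i _ => continuousOn_finsetSum _ fun j _ => (hdc i j).pow 2
    have h0 : ∫ x, ψ x * (∑ i, ∑ j, pd (g i) j x ^ 2) =
        ∫ x in ball (0:E3) R, ψ x * (∑ i, ∑ j, pd (g i) j x ^ 2) := by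
      refine (setIntegral_eq_integral_of_forall_compl_eq_zero fun x hx => ?_).symm
      rw [image_eq_zero_of_notMem_tsupport fun h => hx (hψR h), zero_mul]
    rw [h0]
    exact integral_mono (h_integrable hcd).integrableOn (hson hcd) fun x => mul_le_of_le_one_left
      (Finset.sum_nonneg fun i _ => Finset.sum_nonneg fun j _ => sq_nonneg _) (hψ1 x)
  have hpt : ∀ x, ψ x * (3 / 2 * ((∑ k, g k x ^ 2) + s ^ 2) ^ (-(1 / 4) : ℝ) * ∑ k, g k x * a k x) ≤
      (∑ j, ψ x * pd (pd (fun x => ((∑ k, g k x ^ 2) + s ^ 2) ^ (3 / 4 : ℝ)) j) j x)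
      + 9 / 4 * (∑ j, ψ x * (((∑ k, g k x ^ 2) + s ^ 2) ^ (1 / 2 : ℝ) * g j x ^ 2))
      + 3 / 4 * (ψ x * ∑ i, ∑ j, pd (g i) j x ^ 2)
      + 3 / 2 * ∑ i, ψ x * (((∑ k, g k x ^ 2) + s ^ 2) ^ (1 / 4 : ℝ) * |pd p i x|) := by
    intro x
    by_cases hx : x ∈ tsupport ψ
    · have hx2 := hψ2 hx
      have ha' : ∀ i, a i x = ∑ j, pd (pd (g i) j) j x
          + (-(∑ j, g j x * pd (g i) j x) - pd p i x) := fun i => by linarith [heq x hx2 i]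
      have hl := lower_order_le hs2 (fun k => g k x) (fun i j => pd (g i) j x) fun i => pd p i x
      have hd := Finset.sum_le_sum fun j (_ : j ∈ Finset.univ) => mul_sum_pd_pd_le hs2 hg hx2 j
      have hsplit : 3 / 2 * ((∑ k, g k x ^ 2) + s ^ 2) ^ (-(1 / 4) : ℝ) * ∑ k, g k x * a k x =
          (∑ j, 3 / 2 * ((∑ k, g k x ^ 2) + s ^ 2) ^ (-(1 / 4) : ℝ) *
            ∑ k, g k x * pd (pd (g k) j) j x) +
          3 / 2 * ((∑ k, g k x ^ 2) + s ^ 2) ^ (-(1 / 4) : ℝ) *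
            ∑ i, g i x * (-(∑ j, g j x * pd (g i) j x) - pd p i x) := by
        simp_rw [ha', mul_add, Finset.sum_add_distrib, mul_add, ← Finset.mul_sum]
        rw [Finset.sum_comm]
        simp_rw [← Finset.mul_sum]
      simp_rw [← Finset.mul_sum] at hl ⊢
      calc _ ≤ ψ x * (_ + _) := mul_le_mul_of_nonneg_left
            (hsplit.le.trans (add_le_add hd hl)) (hψ0 x)
        _ = _ := by ring
    · simp [image_eq_zero_of_notMem_tsupport hx]
  have hiW : Integrable fun x => ∑ j, ψ x *
      pd (pd (fun x => ((∑ k, g k x ^ 2) + s ^ 2) ^ (3 / 4 : ℝ)) j) j x :=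
    integrable_finsetSum _ fun j _ => h_integrable (hWc j)
  have hiC : ∀ j, Integrable fun x =>
      ψ x * (((∑ k, g k x ^ 2) + s ^ 2) ^ (1 / 2 : ℝ) * g j x ^ 2) :=
    fun j => h_integrable ((hXc _).mul ((hc j).pow 2))
  have hiP : ∀ i, Integrable fun x =>
      ψ x * (((∑ k, g k x ^ 2) + s ^ 2) ^ (1 / 4 : ℝ) * |pd p i x|) :=
    fun i => h_integrable ((hXc _).mul (hpc i).abs)
  have hiD : Integrable fun x => ψ x * ∑ i, ∑ j, pd (g i) j x ^ 2 :=
    h_integrable (continuousOn_finsetSum _ fun i _ => continuousOn_finsetSum _ fun j _ => (hdc i j).pow 2)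
  have hiL : Integrable fun x =>
      ψ x * (3 / 2 * ((∑ k, g k x ^ 2) + s ^ 2) ^ (-(1 / 4) : ℝ) * ∑ k, g k x * a k x) :=
    h_integrable ((continuousOn_const.mul (hXc _)).mul
      (continuousOn_finsetSum _ fun k _ => (hc k).mul (ha k).continuousOn))
  have hiC' := (integrable_finsetSum Finset.univ fun j _ => hiC j).const_mul (9 / 4)
  have hiP' := (integrable_finsetSum Finset.univ fun j _ => hiP j).const_mul (3 / 2)
  have hiD' := hiD.const_mul (3 / 4)
  calc _ ≤ _ := integral_mono hiL (((hiW.add hiC').add hiD').add hiP') hpt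
    _ = (∑ j, ∫ x, ψ x * pd (pd (fun x => ((∑ k, g k x ^ 2) + s ^ 2) ^ (3 / 4 : ℝ)) j) j x)
        + 9 / 4 * (∑ j, ∫ x, ψ x * (((∑ k, g k x ^ 2) + s ^ 2) ^ (1 / 2 : ℝ) * g j x ^ 2))
        + 3 / 4 * (∫ x, ψ x * ∑ i, ∑ j, pd (g i) j x ^ 2)
        + 3 / 2 * ∑ i, ∫ x, ψ x * (((∑ k, g k x ^ 2) + s ^ 2) ^ (1 / 4 : ℝ) * |pd p i x|) := by
        rw [integral_add' ((hiW.add hiC').add hiD') hiP', integral_add' (hiW.add hiC') hiD',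
          integral_add' hiW hiC', integral_const_mul, integral_const_mul, integral_const_mul,
          integral_finsetSum _ fun j _ => h_integrable (hWc j), integral_finsetSum _ fun j _ => hiC j,
          integral_finsetSum _ fun j _ => hiP j]
    _ ≤ (∑ _j : Fin 3, K₁ * (s⁻¹ * A + s))
        + 9 / 4 * (∑ i, (1 + y) * (K₂ * ∫ x in ball (0:E3) R, ∑ j, pd (g i) j x ^ 2))
        + 3 / 4 * A
        + 3 / 2 * ∑ i, (1 + y) * (K₃ * ((∫ x in ball (0:E3) R, ∑ j, |pd (pd p i) j x|)
          + K₄ * (s⁻¹ * A + s))) := by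
        refine add_le_add (add_le_add (add_le_add (Finset.sum_le_sum fun j _ => h1g j) ?_) ?_) ?_
        · exact mul_le_mul_of_nonneg_left (Finset.sum_le_sum fun j _ => hconv j) (by norm_num)
        · exact mul_le_mul_of_nonneg_left hdiss (by norm_num)
        · exact mul_le_mul_of_nonneg_left (Finset.sum_le_sum fun j _ => hpres j) (by norm_num)
    _ = 3 * K₁ * (s⁻¹ * A + s) + 9 / 4 * ((1 + y) * (K₂ * A)) + 3 / 4 * A
        + 3 / 2 * ((1 + y) * (K₃ * (D + 3 * K₄ * (s⁻¹ * A + s)))) := by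
        rw [hAsum, hDsum]
        simp only [Fin.sum_univ_three]
        ring
    _ ≤ 3 * K₁ * ((1 + y) * (D + s⁻¹ * A + s)) + 9 / 4 * ((1 + y) * (K₂ * (D + s⁻¹ * A + s)))
        + 3 / 4 * ((1 + y) * (D + s⁻¹ * A + s))
        + 3 / 2 * ((1 + y) * (K₃ * ((D + s⁻¹ * A + s) + 3 * K₄ * (D + s⁻¹ * A + s)))) := by
        have hsA : 0 ≤ s⁻¹ * A := by positivity
        have hB : 0 ≤ D + s⁻¹ * A + s := by positivity
        have e1 : D + s⁻¹ * A + s ≤ (1 + y) * (D + s⁻¹ * A + s) :=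
          le_mul_of_one_le_left hB (by linarith)
        gcongr ?_ + ?_ + ?_ + ?_
        · exact mul_le_mul_of_nonneg_left (by linarith) (by positivity)
        · gcongr
          linarith
        · exact mul_le_mul_of_nonneg_left (by linarith) (by norm_num)
        · gcongr <;> linarith
    _ = _ := by ring

/-! ### Evolution in time -/

lemma integral_mul_apply_eq_zero {φ : E3 → ℝ} {R : ℝ} (hφ : Continuous φ)
    (hsupp : tsupport φ ⊆ ball (0:E3) R) {w : E3 → E3}
    (hw : ∀ i, ContinuousOn (fun x => w x i) (ball 0 R)) (h : ∫ x, φ x • w x = 0) (i : Fin 3) :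
    ∫ x, φ x * w x i = 0 := by
  have hw' : ContinuousOn w (ball 0 R) := by
    have : ContinuousOn (fun x => WithLp.ofLp (w x)) (ball 0 R) := continuousOn_pi.2 hw
    exact (PiLp.continuous_toLp 2 _).comp_continuousOn this
  have hi : Integrable fun x => φ x • w x := by
    have h1 : Integrable fun x => φ x * ‖w x‖ :=
      integrable_mul_of_tsupport_subset hφ hsupp hw'.norm
    have h2 : IntegrableOn (fun x => φ x • w x) (ball 0 R) := by
      refine Integrable.mono h1.integrableOn ((hφ.continuousOn.smul hw').aestronglyMeasurable
        measurableSet_ball) (ae_of_all _ fun x => ?_)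
      simp [norm_smul]
    refine h2.integrable_of_forall_notMem_eq_zero fun x hx => ?_
    rw [image_eq_zero_of_notMem_tsupport fun h => hx (hsupp h), zero_smul]
  have h3 := (EuclideanSpace.proj (𝕜 := ℝ) i).integral_comp_comm hi
  rw [h] at h3
  simpa using h3

/-- The differential inequality satisfied by the localized `L^{3/2}` energy. -/
lemma exists_energy_hasDerivAt {φ ψ : E3 → ℝ} (hφs : ContDiff ℝ (⊤ : ℕ∞) φ)
    (hφ0 : ∀ x, 0 ≤ φ x) {r R : ℝ} (hr : 0 < r) (hrR : r < R) (hR : R < 2)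
    (hφsupp : tsupport φ ⊆ ball (0:E3) R) (hφint : ∫ x : E3, φ x = 1)
    (hψ : ContDiff ℝ (⊤ : ℕ∞) ψ) (hψ0 : ∀ x, 0 ≤ ψ x) (hψ1 : ∀ x, ψ x ≤ 1)
    (hψsupp : tsupport ψ ⊆ ball (0:E3) r) :
    ∃ K > 0, ∀ (s : ℝ) (u : ℝ → E3 → E3) (P : ℝ → E3 → ℝ), 0 < s → s ≤ 1 →
      IsNSSolution u P (Ioo (-4:ℝ) 0 ×ˢ ball (0:E3) 2) →
      (∀ t ∈ Ioo (-4:ℝ) 0, ∀ i, ∫ x, φ x * u t x i = 0) →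
      ∀ t ∈ Ioo (-4:ℝ) 0, ∃ y',
        HasDerivAt (fun t => ∫ x, ψ x * ((∑ k, u t x k ^ 2) + s ^ 2) ^ (3 / 4 : ℝ)) y' t ∧
        y' ≤ K * (1 + ∫ x, ψ x * ((∑ k, u t x k ^ 2) + s ^ 2) ^ (3 / 4 : ℝ)) *
          ((∫ x in ball (0:E3) R, ∑ i, ∑ j, |pd (pd (P t) i) j x|)
            + s⁻¹ * (∫ x in ball (0:E3) R, gradSq (u t) x) + s) := by
  obtain ⟨K, hK, h⟩ := exists_integral_time_derivative_le hφs hφ0 hr hrR hR hφsupp hφint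
    hψ hψ0 hψ1 hψsupp
  refine ⟨K, hK, fun s u P hs hs1 hNS hmean t ht => ?_⟩
  have hψ2 := hψsupp.trans (ball_subset_ball (hrR.trans hR).le)
  have hφ2 := hφsupp.trans (ball_subset_ball hR.le)
  have hu : ∀ i, SmoothOnCyl fun t x => u t x i := fun i =>
    (EuclideanSpace.proj (𝕜 := ℝ) i).contDiff.comp_contDiffOn hNS.1
  have hP : SmoothOnCyl P := hNS.2.1
  have hW : SmoothOnCyl fun t x => ((∑ k, u t x k ^ 2) + s ^ 2) ^ (3 / 4 : ℝ) :=
    contDiffOn_rpow_sum_sq (pow_pos hs 2) hu _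
  refine ⟨_, hW.hasDerivAt_integral hψ.continuous hψ2 ht, ?_⟩
  have hmean' : ∀ i, ∫ x, φ x * deriv (fun s => u s x i) t = 0 := by
    intro i
    have h1 := (hu i).hasDerivAt_integral hφs.continuous hφ2 ht
    refine h1.unique ((hasDerivAt_const t (0:ℝ)).congr_of_eventuallyEq ?_)
    filter_upwards [isOpen_Ioo.mem_nhds ht] with t' ht' using hmean t' ht' i
  have h2 := h s (fun i x => u t x i) (fun i x => deriv (fun s => u s x i) t) (P t) hs hs1
    (fun i => (hu i).slice ht) (fun i => (hu i).deriv_time.slice ht) (hP.slice ht) (hmean t ht)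
    hmean' fun x hx i => hNS.2.2.1 (t, x) ⟨ht, hx⟩ i
  refine le_trans (le_of_eq (integral_congr_ae (ae_of_all _ fun x => ?_))) h2
  by_cases hx : x ∈ tsupport ψ
  · simp only
    congr 1
    exact (hasDerivAt_rpow_sum_sq (pow_pos hs 2) fun k =>
      ((hu k).hasDerivAt ht (hψ2 hx)).differentiableAt.hasDerivAt).deriv
  · simp [image_eq_zero_of_notMem_tsupport hx]

lemma log_one_add_sub_le_integral {y h : ℝ → ℝ} {K a b : ℝ} (hab : a ≤ b)
    (hy0 : ∀ t ∈ Icc a b, 0 ≤ y t) (hh : IntegrableOn h (Icc a b))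
    (hy : ∀ t ∈ Icc a b, ∃ y', HasDerivAt y y' t ∧ y' ≤ K * (1 + y t) * h t) :
    Real.log (1 + y b) - Real.log (1 + y a) ≤ K * ∫ t in Icc a b, h t := by
  have hd : ∀ t ∈ Icc a b, HasDerivAt (fun t => Real.log (1 + y t)) (deriv y t / (1 + y t)) t := by
    intro t ht
    obtain ⟨y', hy', -⟩ := hy t ht
    exact (hy'.differentiableAt.hasDerivAt.const_add 1).log (by linarith [hy0 t ht])
  have h1 := intervalIntegral.sub_le_integral_of_hasDeriv_right_of_le hab
    (fun t ht => (hd t ht).continuousAt.continuousWithinAt)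
    (fun t ht => (hd t (Ioo_subset_Icc_self ht)).hasDerivWithinAt) (hh.const_mul K)
    fun t ht => by
      obtain ⟨y', hy', hle⟩ := hy t (Ioo_subset_Icc_self ht)
      rw [hy'.deriv, div_le_iff₀ (by linarith [hy0 t (Ioo_subset_Icc_self ht)])]
      linarith
  refine h1.trans (le_of_eq ?_)
  rw [intervalIntegral.integral_const_mul, intervalIntegral.integral_of_le hab,
    integral_Icc_eq_integral_Ioc]

lemma integrableOn_integral_ball {F : ℝ → E3 → ℝ} {R c : ℝ} (hR : R < 2)
    (hF : ContinuousOn (fun q : ℝ × E3 => F q.1 q.2) (Ioo (-4:ℝ) 0 ×ˢ ball (0:E3) 2))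
    (hF0 : ∀ t x, 0 ≤ F t x) (hc : 0 ≤ c)
    (h : ∫⁻ t in Ioo (-4:ℝ) 0, ∫⁻ x in ball (0:E3) 2, ENNReal.ofReal (F t x) ≤
      ENNReal.ofReal c) :
    IntegrableOn (fun t => ∫ x in ball (0:E3) R, F t x) (Ioo (-4:ℝ) 0) ∧
      ∫ t in Ioo (-4:ℝ) 0, ∫ x in ball (0:E3) R, F t x ≤ c := by
  have hslice : ∀ t ∈ Ioo (-4:ℝ) 0, ContinuousOn (F t) (ball (0:E3) 2) := fun t ht =>
    hF.comp (continuousOn_const.prodMk continuousOn_id) fun x hx => ⟨ht, hx⟩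
  have heq : ∀ t ∈ Ioo (-4:ℝ) 0, ∫ x in ball (0:E3) R, F t x =
      (∫⁻ x in ball (0:E3) R, ENNReal.ofReal (F t x)).toReal := fun t ht =>
    integral_eq_lintegral_of_nonneg_ae (ae_of_all _ (hF0 t))
      (((hslice t ht).mono (ball_subset_ball hR.le)).aestronglyMeasurable measurableSet_ball)
  have hle : ∫⁻ t in Ioo (-4:ℝ) 0, ∫⁻ x in ball (0:E3) R, ENNReal.ofReal (F t x) ≤
      ENNReal.ofReal c :=
    (lintegral_mono fun t => lintegral_mono_set (ball_subset_ball hR.le)).trans h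
  have hne := (hle.trans_lt ENNReal.ofReal_lt_top).ne
  have hm : AEMeasurable (fun t => ∫⁻ x in ball (0:E3) R, ENNReal.ofReal (F t x))
      (volume.restrict (Ioo (-4:ℝ) 0)) := by
    refine AEMeasurable.lintegral_prod_right' (f := fun q : ℝ × E3 => ENNReal.ofReal (F q.1 q.2)) ?_
    rw [Measure.prod_restrict]
    exact ((hF.mono (prod_mono subset_rfl (ball_subset_ball hR.le))).aemeasurable
      (measurableSet_Ioo.prod measurableSet_ball)).ennreal_ofReal
  have hae : (fun t => ∫ x in ball (0:E3) R, F t x) =ᵐ[volume.restrict (Ioo (-4:ℝ) 0)]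
      fun t => (∫⁻ x in ball (0:E3) R, ENNReal.ofReal (F t x)).toReal := by
    filter_upwards [ae_restrict_mem measurableSet_Ioo] with t ht using heq t ht
  refine ⟨(integrable_toReal_of_lintegral_ne_top hm hne).congr hae.symm, ?_⟩
  rw [integral_congr_ae hae, integral_toReal hm (ae_lt_top' hm hne)]
  exact ENNReal.toReal_le_of_le_ofReal hc hle

lemma abs_pd_pd_le_norm_iteratedFDeriv {f : E3 → ℝ} (hf : ContDiffOn ℝ (⊤ : ℕ∞) f (ball 0 2))
    {x : E3} (hx : x ∈ ball (0:E3) 2) (i j : Fin 3) :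
    |pd (pd f i) j x| ≤ ‖iteratedFDeriv ℝ 2 f x‖ := by
  have hd : DifferentiableAt ℝ (fderiv ℝ f) x :=
    ((hf.fderiv_of_isOpen isOpen_ball (m := (⊤ : ℕ∞)) (by simp)).contDiffAt
      (isOpen_ball.mem_nhds hx)).differentiableAt (by simp)
  have h1 : pd (pd f i) j x = iteratedFDeriv ℝ 2 f x
      ![EuclideanSpace.single j 1, EuclideanSpace.single i 1] := by
    rw [iteratedFDeriv_two_apply]
    have h2 : HasFDerivAt (pd f i) _ x := hd.hasFDerivAt.clm_apply (hasFDerivAt_const _ x)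
    rw [pd, h2.fderiv]
    simp
  rw [h1, ← Real.norm_eq_abs]
  refine (ContinuousMultilinearMap.le_opNorm _ _).trans (le_of_eq ?_)
  simp [Fin.prod_univ_two]

/-- A priori bound on the localized `L^{3/2}` energy with regularization parameter `s`. -/
lemma exists_energy_le {φ ψ : E3 → ℝ} (hφs : ContDiff ℝ (⊤ : ℕ∞) φ)
    (hφ0 : ∀ x, 0 ≤ φ x) {r R : ℝ} (hr : 0 < r) (hrR : r < R) (hR : R < 2)
    (hφsupp : tsupport φ ⊆ ball (0:E3) R) (hφint : ∫ x : E3, φ x = 1)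
    (hψ : ContDiff ℝ (⊤ : ℕ∞) ψ) (hψ0 : ∀ x, 0 ≤ ψ x) (hψ1 : ∀ x, ψ x ≤ 1)
    (hψsupp : tsupport ψ ⊆ ball (0:E3) r) :
    ∃ K > 0, ∀ (s : ℝ) (u : ℝ → E3 → E3) (P : ℝ → E3 → ℝ), 0 < s → s ≤ 1 →
      IsNSSolution u P (Ioo (-4:ℝ) 0 ×ˢ ball (0:E3) 2) →
      (∀ t ∈ Ioo (-4:ℝ) 0, ∀ i, ∫ x, φ x * u t x i = 0) →
      (∫⁻ t in Ioo (-4:ℝ) 0, ∫⁻ x in ball (0:E3) 2,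
          ENNReal.ofReal (gradSq (u t) x)) ≤ ENNReal.ofReal (s ^ 2) →
      (∫⁻ t in Ioo (-4:ℝ) 0, ∫⁻ x in ball (0:E3) 2,
          ENNReal.ofReal ‖iteratedFDeriv ℝ 2 (P t) x‖) ≤ ENNReal.ofReal (s ^ 2) →
      ∀ t ∈ Ioo (-(9:ℝ)/4) 0,
        ∫ x, ψ x * ((∑ k, u t x k ^ 2) + s ^ 2) ^ (3 / 4 : ℝ) ≤ K * s := by
  obtain ⟨K₁, hK₁, hX⟩ := exists_integral_sum_sq_add_le hφs.continuous hφ0 (hr.trans hrR) hR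
    hφsupp hφint
  obtain ⟨K₂, hK₂, hE⟩ := exists_energy_hasDerivAt hφs hφ0 hr hrR hR hφsupp hφint hψ hψ0 hψ1 hψsupp
  set L := 2 * K₁ + 14 * K₂ with hL
  refine ⟨L * Real.exp L, by positivity, fun s u P hs hs1 hNS hmean hgrad hpress t ht => ?_⟩
  have hs2 : 0 < s ^ 2 := pow_pos hs 2
  have hs2s : s ^ 2 ≤ s := by nlinarith
  have hinv : s⁻¹ * s ^ 2 = s := by field_simp
  have hu : ∀ i, SmoothOnCyl fun t x => u t x i := fun i =>
    (EuclideanSpace.proj (𝕜 := ℝ) i).contDiff.comp_contDiffOn hNS.1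
  have hP : SmoothOnCyl P := hNS.2.1
  have hW : SmoothOnCyl fun t x => ((∑ k, u t x k ^ 2) + s ^ 2) ^ (3 / 4 : ℝ) :=
    contDiffOn_rpow_sum_sq hs2 hu _
  have hψR := hψsupp.trans (ball_subset_ball hrR.le)
  have hψ2 := hψR.trans (ball_subset_ball hR.le)
  have hE' := hE s u P hs hs1 hNS hmean
  set y : ℝ → ℝ := fun t => ∫ x, ψ x * ((∑ k, u t x k ^ 2) + s ^ 2) ^ (3 / 4 : ℝ)
  have hXpos : ∀ t x, 0 < (∑ k, u t x k ^ 2) + s ^ 2 := fun t x => sum_sq_add_pos hs2 fun k => u t x k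
  have hy0 : ∀ t, 0 ≤ y t := fun t =>
    integral_nonneg fun x => mul_nonneg (hψ0 x) (Real.rpow_nonneg (hXpos t x).le _)
  obtain ⟨hAi, hA⟩ := integrableOn_integral_ball (F := fun t => gradSq (u t)) hR
    (continuousOn_finsetSum _ fun i _ => continuousOn_finsetSum _ fun j _ =>
      ((hu i).pd j).continuousOn.pow 2)
    (fun t x => Finset.sum_nonneg fun i _ => Finset.sum_nonneg fun j _ => sq_nonneg _) hs2.le hgrad
  have hpress' : ∫⁻ t in Ioo (-4:ℝ) 0, ∫⁻ x in ball (0:E3) 2,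
      ENNReal.ofReal (∑ i, ∑ j, |pd (pd (P t) i) j x|) ≤ ENNReal.ofReal (9 * s ^ 2) := by
    calc _ ≤ ∫⁻ t in Ioo (-4:ℝ) 0, ∫⁻ x in ball (0:E3) 2,
          ENNReal.ofReal 9 * ENNReal.ofReal ‖iteratedFDeriv ℝ 2 (P t) x‖ := by
          refine setLIntegral_mono' measurableSet_Ioo fun t ht =>
            setLIntegral_mono' measurableSet_ball fun x hx => ?_
          rw [← ENNReal.ofReal_mul (by norm_num)]
          refine ENNReal.ofReal_le_ofReal ?_
          calc _ ≤ ∑ _i : Fin 3, ∑ _j : Fin 3, ‖iteratedFDeriv ℝ 2 (P t) x‖ :=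
                Finset.sum_le_sum fun i _ => Finset.sum_le_sum fun j _ =>
                  abs_pd_pd_le_norm_iteratedFDeriv (hP.slice ht) hx i j
            _ = _ := by
                simp only [Fin.sum_univ_three]
                ring
      _ = ENNReal.ofReal 9 * ∫⁻ t in Ioo (-4:ℝ) 0, ∫⁻ x in ball (0:E3) 2,
          ENNReal.ofReal ‖iteratedFDeriv ℝ 2 (P t) x‖ := by
          simp_rw [lintegral_const_mul' _ _ ENNReal.ofReal_ne_top]
      _ ≤ _ := by
          rw [ENNReal.ofReal_mul (by norm_num)]
          gcongr
  obtain ⟨hDi, hD⟩ := integrableOn_integral_ball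
    (F := fun t x => ∑ i, ∑ j, |pd (pd (P t) i) j x|) hR
    (continuousOn_finsetSum _ fun i _ => continuousOn_finsetSum _ fun j _ =>
      ((hP.pd i).pd j).continuousOn.abs)
    (fun t x => Finset.sum_nonneg fun i _ => Finset.sum_nonneg fun j _ => abs_nonneg _)
    (by positivity) hpress'
  have hA0 : ∀ t, 0 ≤ ∫ x in ball (0:E3) R, gradSq (u t) x := fun t => integral_nonneg fun x =>
    Finset.sum_nonneg fun i _ => Finset.sum_nonneg fun j _ => sq_nonneg _
  have hD0 : ∀ t, 0 ≤ ∫ x in ball (0:E3) R, ∑ i, ∑ j, |pd (pd (P t) i) j x| :=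
    fun t => integral_nonneg fun x =>
      Finset.sum_nonneg fun i _ => Finset.sum_nonneg fun j _ => abs_nonneg _
  set A : ℝ → ℝ := fun t => ∫ x in ball (0:E3) R, gradSq (u t) x
  set D : ℝ → ℝ := fun t => ∫ x in ball (0:E3) R, ∑ i, ∑ j, |pd (pd (P t) i) j x|
  -- an initial time with small energy
  have hsub : Ioo (-4:ℝ) (-9/4) ⊆ Ioo (-4) 0 := Ioo_subset_Ioo_right (by norm_num)
  obtain ⟨t₀, ht₀, hAt₀⟩ : ∃ t₀ ∈ Ioo (-4:ℝ) (-9/4), A t₀ ≤ s ^ 2 := by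
    obtain ⟨t₀, ht₀, hle⟩ := exists_le_setAverage (μ := volume) (s := Ioo (-4:ℝ) (-9/4)) (f := A)
      (by rw [Real.volume_Ioo]; norm_num) (by rw [Real.volume_Ioo]; exact ENNReal.ofReal_ne_top)
      (hAi.mono_set hsub)
    refine ⟨t₀, ht₀, hle.trans ?_⟩
    rw [setAverage_eq, Real.volume_real_Ioo_of_le (by norm_num), smul_eq_mul]
    have : ∫ t in Ioo (-4:ℝ) (-9/4), A t ≤ s ^ 2 :=
      (setIntegral_mono_set hAi (ae_of_all _ hA0) hsub.eventuallyLE).trans hA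
    norm_num
    linarith
  have hyt₀ : y t₀ ≤ 2 * K₁ * s := by
    have h4 := hsub ht₀
    have hXc : ContinuousOn (fun x => (∑ k, u t₀ x k ^ 2) + s ^ 2) (ball (0:E3) 2) :=
      (continuousOn_finsetSum _ fun k _ => ((hu k).slice h4).continuousOn.pow 2).add
        continuousOn_const
    have h0 : y t₀ = ∫ x in ball (0:E3) R, ψ x * ((∑ k, u t₀ x k ^ 2) + s ^ 2) ^ (3 / 4 : ℝ) := by
      refine (setIntegral_eq_integral_of_forall_compl_eq_zero fun x hx => ?_).symm
      rw [image_eq_zero_of_notMem_tsupport fun h => hx (hψR h), zero_mul]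
    calc y t₀ ≤ ∫ x in ball (0:E3) R, s⁻¹ * ((∑ k, u t₀ x k ^ 2) + s ^ 2) := by
          rw [h0]
          refine integral_mono (integrable_mul_of_tsupport_subset hψ.continuous hψ2
            (hW.slice h4).continuousOn).integrableOn
            ((integrableOn_ball_of_continuousOn hR hXc).const_mul _) fun x => ?_
          refine (mul_le_of_le_one_left (Real.rpow_nonneg (hXpos _ x).le _) (hψ1 x)).trans
            (rpow_three_quarters_le hs hs1 ?_)
          have : 0 ≤ ∑ k, u t₀ x k ^ 2 := Finset.sum_nonneg fun _ _ => sq_nonneg _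
          linarith
      _ ≤ s⁻¹ * (K₁ * (A t₀ + s ^ 2)) := by
          rw [integral_const_mul]
          gcongr
          exact hX (s ^ 2) (fun i x => u t₀ x i) hs2.le (fun i => (hu i).slice h4) (hmean t₀ h4)
      _ ≤ s⁻¹ * (K₁ * (s ^ 2 + s ^ 2)) := by gcongr
      _ = 2 * K₁ * (s⁻¹ * s ^ 2) := by ring
      _ = 2 * K₁ * s := by rw [hinv]
  have ht₀t : t₀ ≤ t := by linarith [ht₀.2, ht.1]
  have hIcc : Icc t₀ t ⊆ Ioo (-4:ℝ) 0 := fun τ hτ => ⟨ht₀.1.trans_le hτ.1, hτ.2.trans_lt ht.2⟩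
  have hDAi : IntegrableOn (fun t => D t + s⁻¹ * A t) (Ioo (-4:ℝ) 0) := hDi.add (hAi.const_mul _)
  have hsi : IntegrableOn (fun _ => s) (Ioo (-4:ℝ) 0) :=
    integrableOn_const (by rw [Real.volume_Ioo]; simp)
  have hhi : IntegrableOn (fun t => D t + s⁻¹ * A t + s) (Ioo (-4:ℝ) 0) := hDAi.add hsi
  have hlog := log_one_add_sub_le_integral ht₀t (fun τ _ => hy0 τ) (hhi.mono_set hIcc)
    fun τ hτ => hE' τ (hIcc hτ)
  have hhle : ∫ t in Icc t₀ t, (D t + s⁻¹ * A t + s) ≤ 14 * s := by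
    calc _ ≤ ∫ t in Ioo (-4:ℝ) 0, (D t + s⁻¹ * A t + s) := by
          refine setIntegral_mono_set hhi (ae_of_all _ fun τ => ?_) hIcc.eventuallyLE
          have := mul_nonneg (inv_pos.2 hs).le (hA0 τ)
          exact add_nonneg (add_nonneg (hD0 τ) this) hs.le
      _ = (∫ t in Ioo (-4:ℝ) 0, D t) + s⁻¹ * (∫ t in Ioo (-4:ℝ) 0, A t) + 4 * s := by
          rw [integral_add hDAi hsi, integral_add hDi (hAi.const_mul _), integral_const_mul,
            setIntegral_const, Real.volume_real_Ioo_of_le (by norm_num)]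
          norm_num
      _ ≤ 9 * s ^ 2 + s⁻¹ * s ^ 2 + 4 * s := by
          have := (inv_pos.2 hs).le
          gcongr
      _ ≤ 14 * s := by
          rw [hinv]
          linarith
  have hlog₀ : Real.log (1 + y t₀) ≤ 2 * K₁ * s :=
    (Real.log_le_sub_one_of_pos (by linarith [hy0 t₀])).trans (by linarith)
  have hlogt : Real.log (1 + y t) ≤ L * s := by
    have := mul_le_mul_of_nonneg_left hhle hK₂.le
    rw [hL]
    linarith
  have hLs : L * s ≤ L := mul_le_of_le_one_right (by positivity) hs1
  have h1 : 1 + y t ≤ Real.exp (L * s) :=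
    (Real.log_le_iff_le_exp (by linarith [hy0 t])).1 hlogt
  have h2 : Real.exp (L * s) - 1 ≤ L * s * Real.exp (L * s) := by
    have h3 := mul_le_mul_of_nonneg_right (Real.add_one_le_exp (-(L * s))) (Real.exp_pos (L * s)).le
    rw [← Real.exp_add, neg_add_cancel, Real.exp_zero] at h3
    linarith
  calc y t ≤ L * s * Real.exp (L * s) := by linarith
    _ ≤ L * s * Real.exp L := by gcongr
    _ = _ := by ring

/-- Step 1 of the local study: `L^∞(L^{3/2})` control on `Q_{3/2}`. -/
theorem ns_step1_L32 (φ : E3 → ℝ) (hφs : ContDiff ℝ (⊤ : ℕ∞) φ) (hφ0 : ∀ x, 0 ≤ φ x)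
    (hφsupp : tsupport φ ⊆ ball (0:E3) 1) (hφint : ∫ x : E3, φ x = 1) :
    ∃ η₀ ∈ Set.Ioo (0:ℝ) 1, ∃ C > (0:ℝ), ∀ η : ℝ, 0 < η → η ≤ η₀ →
      ∀ (u : ℝ → E3 → E3) (P : ℝ → E3 → ℝ),
      IsNSSolution u P (Set.Ioo (-4:ℝ) 0 ×ˢ ball (0:E3) 2) →
      (∀ t ∈ Set.Ioo (-4:ℝ) 0, (∫ x : E3, φ x • u t x) = 0) →
      (∀ t ∈ Set.Ioo (-4:ℝ) 0, (∫ x : E3, φ x * P t x) = 0) →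
      (∫⁻ t in Set.Ioo (-4:ℝ) 0, ∫⁻ x in ball (0:E3) 2,
          ENNReal.ofReal (gradSq (u t) x)) ≤ ENNReal.ofReal η →
      (∫⁻ t in Set.Ioo (-4:ℝ) 0, ∫⁻ x in ball (0:E3) 2,
          ENNReal.ofReal ‖iteratedFDeriv ℝ 2 (P t) x‖) ≤ ENNReal.ofReal η →
      ∀ t ∈ Set.Ioo (-(9:ℝ)/4) 0,
        (∫⁻ x in ball (0:E3) (3/2), ENNReal.ofReal (‖u t x‖ ^ ((3:ℝ)/2))) ^ ((2:ℝ)/3)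
          ≤ ENNReal.ofReal (C * η ^ ((1:ℝ)/3)) := by
  let χ : ContDiffBump (0:E3) := ⟨3 / 2, 25 / 16, by norm_num, by norm_num⟩
  have hχ : tsupport χ ⊆ ball (0:E3) (13 / 8) := by
    rw [χ.tsupport_eq]
    exact closedBall_subset_ball (by norm_num [χ])
  obtain ⟨K, hK, h⟩ := exists_energy_le (ψ := χ) hφs hφ0 (r := 13 / 8) (R := 15 / 8)
    (by norm_num) (by norm_num) (by norm_num) (hφsupp.trans (ball_subset_ball (by norm_num)))
    hφint χ.contDiff (fun _ => χ.nonneg) (fun _ => χ.le_one) hχ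
  refine ⟨1 / 2, by norm_num, K ^ (2 / 3 : ℝ), by positivity,
    fun η hη hη₀ u P hNS hmean _ hgrad hpress t ht => ?_⟩
  have hs : 0 < √η := Real.sqrt_pos.2 hη
  have hs2 : √η ^ 2 = η := Real.sq_sqrt hη.le
  have hs1 : √η ≤ 1 := Real.sqrt_le_one.2 (by linarith)
  have ht4 : t ∈ Ioo (-4:ℝ) 0 := ⟨by linarith [ht.1], ht.2⟩
  have hφ2 := hφsupp.trans (ball_subset_ball (by norm_num : (1:ℝ) ≤ 2))
  have hu : ∀ i, SmoothOnCyl fun t x => u t x i := fun i =>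
    (EuclideanSpace.proj (𝕜 := ℝ) i).contDiff.comp_contDiffOn hNS.1
  have hy := h √η u P hs hs1 hNS
    (fun t ht => integral_mul_apply_eq_zero hφs.continuous hφ2
      (fun i => ((hu i).slice ht).continuousOn) (hmean t ht))
    (by rwa [hs2]) (by rwa [hs2]) t ht
  have hXpos : ∀ x, 0 < (∑ k, u t x k ^ 2) + √η ^ 2 := fun x =>
    sum_sq_add_pos (pow_pos hs 2) fun k => u t x k
  have hW : ContinuousOn (fun x => ((∑ k, u t x k ^ 2) + √η ^ 2) ^ (3 / 4 : ℝ)) (ball (0:E3) 2) :=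
    (contDiffOn_rpow_sum_sq (pow_pos hs 2) (fun i => (hu i).slice ht4) _).continuousOn
  have hi := integrable_mul_of_tsupport_subset χ.continuous
    (hχ.trans (ball_subset_ball (by norm_num : (13 / 8 : ℝ) ≤ 2))) hW
  have hnn : ∀ x, 0 ≤ χ x * ((∑ k, u t x k ^ 2) + √η ^ 2) ^ (3 / 4 : ℝ) := fun x =>
    mul_nonneg χ.nonneg (Real.rpow_nonneg (hXpos x).le _)
  have hlint : ∫⁻ x in ball (0:E3) (3/2), ENNReal.ofReal (‖u t x‖ ^ ((3:ℝ)/2)) ≤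
      ENNReal.ofReal (K * √η) := by
    calc _ ≤ ∫⁻ x in ball (0:E3) (3/2),
          ENNReal.ofReal (χ x * ((∑ k, u t x k ^ 2) + √η ^ 2) ^ (3 / 4 : ℝ)) := by
          refine setLIntegral_mono' measurableSet_ball fun x hx => ENNReal.ofReal_le_ofReal ?_
          rw [χ.one_of_mem_closedBall (ball_subset_closedBall hx), one_mul]
          have h1 : ‖u t x‖ ^ 2 ≤ (∑ k, u t x k ^ 2) + √η ^ 2 := by
            rw [EuclideanSpace.real_norm_sq_eq]
            linarith [pow_pos hs 2]
          calc ‖u t x‖ ^ ((3:ℝ)/2) = (‖u t x‖ ^ 2) ^ (3 / 4 : ℝ) := by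
                rw [← Real.rpow_natCast, ← Real.rpow_mul (norm_nonneg _)]
                norm_num
            _ ≤ _ := by gcongr
      _ ≤ ∫⁻ x, ENNReal.ofReal (χ x * ((∑ k, u t x k ^ 2) + √η ^ 2) ^ (3 / 4 : ℝ)) :=
          setLIntegral_le_lintegral _ _
      _ = ENNReal.ofReal (∫ x, χ x * ((∑ k, u t x k ^ 2) + √η ^ 2) ^ (3 / 4 : ℝ)) :=
          (ofReal_integral_eq_lintegral_ofReal hi (ae_of_all _ hnn)).symm
      _ ≤ _ := ENNReal.ofReal_le_ofReal hy
  calc _ ≤ ENNReal.ofReal (K * √η) ^ ((2:ℝ)/3) := by gcongr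
    _ = ENNReal.ofReal (K ^ (2 / 3 : ℝ) * η ^ ((1:ℝ)/3)) := by
        rw [ENNReal.ofReal_rpow_of_nonneg (by positivity) (by norm_num),
          Real.mul_rpow hK.le hs.le, Real.sqrt_eq_rpow, ← Real.rpow_mul hη.le]
        norm_num
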